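/- arXiv:1203.5022 — 5 statements merged into one kernel-verified Lean document; each statement's English description precedes it below -/
import Mathlib

section
/- Fix an integer n ≥ 0, a real R ∈ (0,1) and a real p ≥ 1 with p ≠ 4. For k = 1,2,… let α_k = j_{n,k} be the k-th positive zero of J_n and set F_k(p) = ( ∫_{α_k R}^{α_k} z |J_n(z)|^p dz / ∫_0^{α_k} z |J_n(z)|^p dz )^{1/p}. Then lim_{k→∞} F_k(p) = (1 − R^{2 − p/2})^{1/p} if 1 ≤ p < 4, and lim_{k→∞} F_k(p) = 0 if p > 4. (F_k(p) equals the ratio ‖u_{n,k}‖_{L_p(D(R))}/‖u_{n,k}‖_{L_p(D)} for the Dirichlet eigenfunction u_{n,k}(r,φ) = J_n(α_k r) cos(nφ) of the unit disk D, where D(R) = {x ∈ ℝ² : R < |x| < 1}; thus focusing modes in the disk are L_p-localized at the origin precisely when p > 4.) -/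
open Real MeasureTheory Filter Topology

/-- The Bessel function of the first kind of order `ν`. -/
noncomputable def besselJ (ν : ℝ) (x : ℝ) : ℝ :=
  ∑' k : ℕ, ((-1 : ℝ) ^ k / ((k.factorial : ℝ) * Real.Gamma ((k : ℝ) + ν + 1))) *
    (x / 2) ^ (2 * (k : ℝ) + ν)

/-- `F_k(p) = ( ∫_{α_k R}^{α_k} z |J_n(z)|^p dz / ∫_0^{α_k} z |J_n(z)|^p dz )^{1/p}`, equal to
`‖u_{n,k}‖_{L_p(D(R))}/‖u_{n,k}‖_{L_p(D)}` for the Dirichlet eigenfunctions of the unit disk. -/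
noncomputable def focusRatio (n : ℕ) (R p : ℝ) (αk : ℝ) : ℝ :=
  ((∫ z in (αk * R)..αk, z * |besselJ n z| ^ p) /
    (∫ z in (0 : ℝ)..αk, z * |besselJ n z| ^ p)) ^ (1 / p)

/-- coefficient -/
noncomputable def bc (m k : ℕ) : ℝ := (-1 : ℝ) ^ k / ((k.factorial : ℝ) * ((k + m).factorial : ℝ))

/-- entire part of the Bessel function -/
noncomputable def bg (m : ℕ) (t : ℝ) : ℝ := ∑' k : ℕ, bc m k * t ^ k

lemma bc_abs_le (m k : ℕ) : |bc m k| ≤ 1 / (k.factorial : ℝ) := by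
  unfold bc
  rw [abs_div, abs_pow, abs_neg, abs_one, one_pow, abs_of_nonneg (by positivity)]
  have h1 : (1 : ℝ) ≤ ((k + m).factorial : ℝ) := by exact_mod_cast Nat.succ_le_of_lt (Nat.factorial_pos _)
  have h2 : (0 : ℝ) < (k.factorial : ℝ) := by exact_mod_cast Nat.factorial_pos _
  apply one_div_le_one_div_of_le h2
  nlinarith

lemma bg_summable (m : ℕ) (t : ℝ) : Summable fun k : ℕ => bc m k * t ^ k := by
  refine Summable.of_norm_bounded (Real.summable_pow_div_factorial |t|) (fun k => ?_)
  rw [norm_mul, norm_pow, Real.norm_eq_abs, Real.norm_eq_abs]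
  calc _ ≤ 1 / (k.factorial : ℝ) * |t| ^ k := by gcongr; exact bc_abs_le m k
    _ = _ := by ring

lemma bc_succ (m k : ℕ) : bc m (k + 1) * ((k + 1 : ℕ) : ℝ) = - bc (m + 1) k := by
  unfold bc
  have h : k + 1 + m = k + (m + 1) := by ring
  rw [h, Nat.factorial_succ k, pow_succ]
  have h1 : ((k + (m + 1)).factorial : ℝ) ≠ 0 := by exact_mod_cast Nat.factorial_ne_zero _
  have h2 : (k.factorial : ℝ) ≠ 0 := by exact_mod_cast Nat.factorial_ne_zero _
  have h3 : ((k + 1 : ℕ) : ℝ) ≠ 0 := by exact_mod_cast Nat.succ_ne_zero k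
  push_cast at *
  field_simp

lemma bg_hasDerivAt (m : ℕ) (t : ℝ) : HasDerivAt (bg m) (- bg (m + 1) t) t := by
  set r : ℝ := |t| + 1 with hr
  have hr0 : 0 < r := by positivity
  have hu : Summable (fun k : ℕ => (k : ℝ) / (k.factorial : ℝ) * r ^ (k - 1)) := by
    rw [← summable_nat_add_iff 1]
    refine (Real.summable_pow_div_factorial r).congr (fun k => ?_)
    rw [Nat.factorial_succ]
    have h2 : (k.factorial : ℝ) ≠ 0 := by exact_mod_cast Nat.factorial_ne_zero _
    have h3 : (k : ℝ) + 1 ≠ 0 := by positivity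
    push_cast
    field_simp
  have key := hasDerivAt_tsum_of_isPreconnected (g := fun (k : ℕ) (t : ℝ) => bc m k * t ^ k)
    (g' := fun (k : ℕ) (t : ℝ) => bc m k * ((k : ℝ) * t ^ (k - 1)))
    hu (t := Metric.ball (0 : ℝ) r) (y₀ := 0) (y := t) Metric.isOpen_ball
    (convex_ball _ _).isPreconnected
    (fun k y _ => (hasDerivAt_pow k y).const_mul _) (fun k y hy => ?_)
    (Metric.mem_ball_self hr0) (bg_summable m 0)
    (by simp [hr])
  · have e : ∑' k : ℕ, bc m k * ((k : ℝ) * t ^ (k - 1)) = - bg (m + 1) t := by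
      have hs : Summable (fun k : ℕ => bc m k * ((k : ℝ) * t ^ (k - 1))) := by
        rw [← summable_nat_add_iff 1]
        refine (bg_summable (m + 1) t).neg.congr (fun k => ?_)
        rw [← mul_assoc, bc_succ, Nat.add_sub_cancel]; ring
      rw [hs.tsum_eq_zero_add]
      unfold bg
      rw [← tsum_neg]
      simp only [Nat.cast_zero, zero_mul, mul_zero, zero_add]
      refine tsum_congr (fun k => ?_)
      rw [← mul_assoc, bc_succ, Nat.add_sub_cancel]; ring
    rw [← e]; exact key
  · have hy' : |y| ≤ r := by
      have := Metric.mem_ball.1 hy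
      rw [Real.dist_eq, sub_zero] at this; exact this.le
    rw [norm_mul, norm_mul, norm_pow, Real.norm_eq_abs, Real.norm_eq_abs, Real.norm_eq_abs, Nat.abs_cast]
    calc _ ≤ 1 / (k.factorial : ℝ) * ((k : ℝ) * r ^ (k - 1)) := by gcongr; exact bc_abs_le m k
      _ = _ := by ring

lemma bg_rec (m : ℕ) (t : ℝ) : t * bg (m + 2) t - (m + 1) * bg (m + 1) t + bg m t = 0 := by
  have h2 : HasSum (fun k : ℕ => bc (m + 2) k * t ^ k * t) (bg (m + 2) t * t) :=
    ((bg_summable (m + 2) t).hasSum).mul_right t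
  have h1 := (((bg_summable (m + 1) t).hasSum).mul_left ((m : ℝ) + 1))
  have h0 := (bg_summable m t).hasSum
  have h3 := (h1.sub h0)
  rw [← hasSum_nat_add_iff' 1] at h3
  have h4 : HasSum (fun k : ℕ => bc (m + 2) k * t ^ k * t) 
     ((m + 1) * bg (m + 1) t - bg m t) := by
    convert! h3 using 1
    · funext k
      unfold bc
      have e1 : k + (m + 2) = (k + m + 1) + 1 := by ring
      have e2 : k + 1 + (m + 1) = (k + m + 1) + 1 := by ring
      have e3 : k + 1 + m = k + m + 1 := by ring
      rw [e1, e2, e3, Nat.factorial_succ (k + m + 1), Nat.factorial_succ k, pow_succ, pow_succ]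
      have h1 : ((k + m + 1).factorial : ℝ) ≠ 0 := by exact_mod_cast Nat.factorial_ne_zero _
      have h2 : (k.factorial : ℝ) ≠ 0 := by exact_mod_cast Nat.factorial_ne_zero _
      have h3 : (k : ℝ) + 1 ≠ 0 := by positivity
      have h4 : (k : ℝ) + m + 1 + 1 ≠ 0 := by positivity
      push_cast
      field_simp
      ring
    · have : ((m : ℝ) + 1) * bc (m + 1) 0 - bc m 0 = 0 := by
        unfold bc
        have h1 : (m.factorial : ℝ) ≠ 0 := by exact_mod_cast Nat.factorial_ne_zero _
        have h3 : (m : ℝ) + 1 ≠ 0 := by positivity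
        simp only [zero_add, Nat.factorial_succ]
        push_cast
        field_simp
        simp
      simp [bg]
      linarith
  have := h2.unique h4
  linarith

/-- Bessel function of integer order -/
noncomputable def bJ (m : ℕ) (x : ℝ) : ℝ := (x / 2) ^ m * bg m ((x / 2) ^ 2)

lemma besselJ_eq (n : ℕ) (x : ℝ) : besselJ n x = bJ n x := by
  unfold besselJ bJ bg
  rw [← tsum_mul_left]
  refine tsum_congr (fun k => ?_)
  have e : (2 * (k : ℝ) + n) = ((2 * k + n : ℕ) : ℝ) := by push_cast; ring
  have e2 : (k : ℝ) + n + 1 = ((k + n : ℕ) : ℝ) + 1 := by push_cast; ring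
  rw [e, Real.rpow_natCast, e2, Real.Gamma_nat_eq_factorial, bc, pow_add, pow_mul]
  ring

lemma bJ_continuous (m : ℕ) : Continuous (bJ m) := by
  have : Continuous (bg m) := continuous_iff_continuousAt.2 fun t => (bg_hasDerivAt m t).continuousAt
  unfold bJ
  fun_prop

lemma bJ_deriv (m : ℕ) (x : ℝ) (hx : 0 < x) :
    HasDerivAt (bJ m) (m / x * bJ m x - bJ (m + 1) x) x := by
  have hh : HasDerivAt (fun x : ℝ => x / 2) (1 / 2) x := (hasDerivAt_id x).div_const 2
  have h1 := hh.fun_pow m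
  have h2 := (bg_hasDerivAt m ((x / 2) ^ 2)).comp x (hh.fun_pow 2)
  refine (h1.mul h2).congr_deriv ?_
  unfold bJ
  rcases m with _ | m
  · simp; ring
  · simp only [Nat.add_sub_cancel, Function.comp]
    push_cast
    field_simp
    ring

lemma bJ_deriv' (m : ℕ) (x : ℝ) (hx : 0 < x) :
    HasDerivAt (bJ (m + 1)) (bJ m x - (m + 1) / x * bJ (m + 1) x) x := by
  refine (bJ_deriv (m + 1) x hx).congr_deriv ?_
  have := bg_rec m ((x / 2) ^ 2)
  have h : bg m ((x / 2) ^ 2) = (m + 1) * bg (m + 1) ((x / 2) ^ 2) - (x / 2) ^ 2 * bg (m + 2) ((x / 2) ^ 2) := by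
    linarith
  unfold bJ
  rw [h]
  push_cast
  field_simp
  ring

lemma bJ_ne (m : ℕ) : ∃ x, 0 < x ∧ bJ m x ≠ 0 := by
  have hc : ContinuousAt (fun x : ℝ => bg m ((x / 2) ^ 2)) 0 := by
    have : Continuous (bg m) := continuous_iff_continuousAt.2 fun t => (bg_hasDerivAt m t).continuousAt
    fun_prop
  have h0 : bg m ((0 / 2) ^ 2) ≠ 0 := by
    unfold bg
    rw [tsum_eq_single 0]
    · simp [bc, Nat.factorial_ne_zero]
    · intro k hk; simp [hk]
  have h1 := hc.eventually_ne h0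
  have h2 : ∀ᶠ x in 𝓝[>] (0 : ℝ), bg m ((x / 2) ^ 2) ≠ 0 ∧ 0 < x :=
    (h1.filter_mono nhdsWithin_le_nhds).and self_mem_nhdsWithin
  obtain ⟨x, hx, hx0⟩ := h2.exists
  exact ⟨x, hx0, mul_ne_zero (by positivity) hx⟩

/-- normalised -/
noncomputable def bu (n : ℕ) (x : ℝ) : ℝ := √x * bJ n x
/-- derivative of normalised -/
noncomputable def bv (n : ℕ) (x : ℝ) : ℝ := (n + 1 / 2) / x * (√x * bJ n x) - √x * bJ (n + 1) x

lemma bu_deriv (n : ℕ) (x : ℝ) (hx : 0 < x) : HasDerivAt (bu n) (bv n x) x := by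
  refine ((Real.hasDerivAt_sqrt hx.ne').mul (bJ_deriv n x hx)).congr_deriv ?_
  unfold bv
  have h : 0 < √x := Real.sqrt_pos.2 hx
  have e : x = √x ^ 2 := (Real.sq_sqrt hx.le).symm
  generalize bJ n x = P
  generalize bJ (n + 1) x = Q
  generalize √x = r at *
  subst e
  field_simp
  ring

lemma bv_deriv (n : ℕ) (x : ℝ) (hx : 0 < x) :
    HasDerivAt (bv n) ((((n : ℝ) ^ 2 - 1 / 4) / x ^ 2 - 1) * bu n x) x := by
  have h1 : HasDerivAt (fun x : ℝ => ((n : ℝ) + 1 / 2) / x) (-((n : ℝ) + 1 / 2) / x ^ 2) x := by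
    have := (hasDerivAt_inv hx.ne').const_mul ((n : ℝ) + 1 / 2)
    refine this.congr_deriv ?_
    ring
  have hs := (Real.hasDerivAt_sqrt hx.ne')
  refine ((h1.mul (hs.mul (bJ_deriv n x hx))).sub (hs.mul (bJ_deriv' n x hx))).congr_deriv ?_
  unfold bu
  simp only [Pi.mul_apply]
  have h : 0 < √x := Real.sqrt_pos.2 hx
  have e : x = √x ^ 2 := (Real.sq_sqrt hx.le).symm
  generalize bJ n x = P
  generalize bJ (n + 1) x = Q
  generalize √x = r at *
  subst e
  field_simp
  ring

lemma energy_mono (u v : ℝ → ℝ) (m : ℝ)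
    (hu : ∀ x, 0 < x → HasDerivAt u (v x) x)
    (hv : ∀ x, 0 < x → HasDerivAt v ((m / x ^ 2 - 1) * u x) x) :
    AntitoneOn (fun x => (u x ^ 2 + v x ^ 2) * exp (|m| / x)) (Set.Ioi 0) ∧
    MonotoneOn (fun x => (u x ^ 2 + v x ^ 2) * exp (-|m| / x)) (Set.Ioi 0) := by
  have hE : ∀ x, 0 < x → HasDerivAt (fun x => u x ^ 2 + v x ^ 2) (2 * (m / x ^ 2) * (u x * v x)) x := by
    intro x hx
    refine (((hu x hx).fun_pow 2).add ((hv x hx).fun_pow 2)).congr_deriv ?_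
    push_cast
    ring
  have hexp : ∀ c x : ℝ, 0 < x → HasDerivAt (fun x : ℝ => exp (c / x)) (exp (c / x) * (-c / x ^ 2)) x := by
    intro c x hx
    have := ((hasDerivAt_inv hx.ne').const_mul c).exp
    refine this.congr_deriv ?_
    simp only [div_eq_mul_inv]
    ring
  have hP : ∀ c x : ℝ, 0 < x → HasDerivAt (fun x => (u x ^ 2 + v x ^ 2) * exp (c / x))
      (exp (c / x) / x ^ 2 * (2 * m * (u x * v x) - c * (u x ^ 2 + v x ^ 2))) x := by
    intro c x hx
    refine ((hE x hx).mul (hexp c x hx)).congr_deriv ?_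
    field_simp
    ring
  have habs : ∀ x, |2 * m * (u x * v x)| ≤ |m| * (u x ^ 2 + v x ^ 2) := by
    intro x
    rw [abs_mul, abs_mul, abs_two, abs_mul]
    have := sq_nonneg (|u x| - |v x|)
    have h1 := sq_abs (u x)
    have h2 := sq_abs (v x)
    have := mul_nonneg (abs_nonneg m) this
    rw [← h1, ← h2]
    nlinarith
  constructor
  · apply antitoneOn_of_deriv_nonpos (convex_Ioi 0)
    · exact fun x hx => (hP _ x hx).continuousAt.continuousWithinAt
    · rw [interior_Ioi]
      exact fun x hx => (hP _ x hx).differentiableAt.differentiableWithinAt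
    · rw [interior_Ioi]
      intro x hx
      rw [(hP _ x hx).deriv]
      have := (abs_le.1 (habs x)).2
      apply mul_nonpos_of_nonneg_of_nonpos (by positivity)
      linarith
  · apply monotoneOn_of_deriv_nonneg (convex_Ioi 0)
    · exact fun x hx => (hP _ x hx).continuousAt.continuousWithinAt
    · rw [interior_Ioi]
      exact fun x hx => (hP _ x hx).differentiableAt.differentiableWithinAt
    · rw [interior_Ioi]
      intro x hx
      rw [(hP _ x hx).deriv]
      have := (abs_le.1 (habs x)).1
      apply mul_nonneg (by positivity)
      linarith

lemma energy_pos (u v : ℝ → ℝ) (m : ℝ)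
    (hu : ∀ x, 0 < x → HasDerivAt u (v x) x)
    (hv : ∀ x, 0 < x → HasDerivAt v ((m / x ^ 2 - 1) * u x) x)
    (hne : ∃ x, 0 < x ∧ u x ≠ 0) (x : ℝ) (hx : 0 < x) : 0 < u x ^ 2 + v x ^ 2 := by
  obtain ⟨h1, h2⟩ := energy_mono u v m hu hv
  obtain ⟨y, hy, hyu⟩ := hne
  have hEy : 0 < u y ^ 2 + v y ^ 2 := by positivity
  by_contra hcon
  have h0 : u x ^ 2 + v x ^ 2 = 0 := le_antisymm (not_lt.1 hcon) (by positivity)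
  rcases le_total x y with h | h
  · have := h1 hx hy h
    simp only [h0, zero_mul] at this
    have : 0 < (u y ^ 2 + v y ^ 2) * exp (|m| / y) := by positivity
    linarith
  · have := h2 hy hx h
    simp only [h0, zero_mul] at this
    have : 0 < (u y ^ 2 + v y ^ 2) * exp (-|m| / y) := by positivity
    linarith

lemma lim_aux (u w : ℝ → ℝ) (a : ℝ → ℝ) (m C : ℝ) (hC : ∀ x, 1 ≤ x → |u x| ≤ C)
    (huc : ContinuousOn u (Set.Ioi 0)) (hw : Continuous w) (hw1 : ∀ x, |w x| ≤ 1)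
    (ha : ∀ x, 0 < x → HasDerivAt a (m / x ^ 2 * (u x * w x)) x) :
    ∃ A, Tendsto a atTop (𝓝 A) := by
  refine ⟨_, tendsto_limUnder_of_hasDerivAt_of_integrableOn_Ioi (a := 1)
    (fun x hx => ha x (lt_trans one_pos hx)) ?_⟩
  have hb : IntegrableOn (fun x : ℝ => |m| * C * x ^ (-2 : ℝ)) (Set.Ioi 1) :=
    (integrableOn_Ioi_rpow_of_lt (by norm_num) one_pos).const_mul _
  refine Integrable.mono' hb ?_ ?_
  · apply ContinuousOn.aestronglyMeasurable _ measurableSet_Ioi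
    have huc' : ContinuousOn u (Set.Ioi 1) := huc.mono (Set.Ioi_subset_Ioi zero_le_one)
    have : ContinuousOn (fun x : ℝ => m / x ^ 2) (Set.Ioi 1) := by
      apply ContinuousOn.div continuousOn_const (by fun_prop)
      intro x hx
      have : (0 : ℝ) < x := lt_trans one_pos hx
      positivity
    exact this.mul (huc'.mul hw.continuousOn)
  · refine (ae_restrict_iff' measurableSet_Ioi).2 (Eventually.of_forall fun x hx => ?_)
    have hx0 : (0 : ℝ) < x := lt_trans one_pos hx
    have h1 := hC x (le_of_lt hx)
    have h2 := hw1 x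
    have hxx : x ^ (-2 : ℝ) = 1 / x ^ 2 := by
      rw [Real.rpow_neg hx0.le]; norm_num
    rw [Real.norm_eq_abs, abs_mul, abs_mul, abs_div, abs_of_pos (by positivity : 0 < x ^ 2), hxx]
    have h3 : |u x| * |w x| ≤ C * 1 := mul_le_mul h1 h2 (abs_nonneg _) ((abs_nonneg _).trans h1)
    calc |m| / x ^ 2 * (|u x| * |w x|) ≤ |m| / x ^ 2 * (C * 1) := by gcongr
      _ = _ := by ring

lemma osc_asymp (u v : ℝ → ℝ) (m : ℝ)
    (hu : ∀ x, 0 < x → HasDerivAt u (v x) x)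
    (hv : ∀ x, 0 < x → HasDerivAt v ((m / x ^ 2 - 1) * u x) x)
    (hne : ∃ x, 0 < x ∧ u x ≠ 0) :
    ∃ A B C : ℝ, 0 < A ^ 2 + B ^ 2 ∧ (∀ x, 1 ≤ x → |u x| ≤ C) ∧
      Tendsto (fun x => u x - (A * cos x + B * sin x)) atTop (𝓝 0) := by
  obtain ⟨h1, h2⟩ := energy_mono u v m hu hv
  have hE1 := energy_pos u v m hu hv hne 1 one_pos
  have hup : ∀ x, 1 ≤ x → u x ^ 2 + v x ^ 2 ≤ (u 1 ^ 2 + v 1 ^ 2) * exp |m| := by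
    intro x hx
    have h0 : (0 : ℝ) < x := by linarith
    have := h1 (Set.mem_Ioi.2 one_pos) (Set.mem_Ioi.2 h0) hx
    simp only [div_one] at this
    refine le_trans ?_ this
    have : 1 ≤ exp (|m| / x) := Real.one_le_exp (by positivity)
    exact le_mul_of_one_le_right (by positivity) this
  have hlo : ∀ x, 1 ≤ x → (u 1 ^ 2 + v 1 ^ 2) * exp (-|m|) ≤ u x ^ 2 + v x ^ 2 := by
    intro x hx
    have h0 : (0 : ℝ) < x := by linarith
    have := h2 (Set.mem_Ioi.2 one_pos) (Set.mem_Ioi.2 h0) hx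
    simp only [div_one] at this
    refine le_trans this ?_
    have : exp (-|m| / x) ≤ 1 := by
      rw [Real.exp_le_one_iff]
      exact div_nonpos_of_nonpos_of_nonneg (by simp) h0.le
    exact mul_le_of_le_one_right (by positivity) this
  set C := √((u 1 ^ 2 + v 1 ^ 2) * exp |m|)
  have hC : ∀ x, 1 ≤ x → |u x| ≤ C := by
    intro x hx
    apply Real.abs_le_sqrt
    have := hup x hx
    nlinarith [sq_nonneg (v x)]
  have huc : ContinuousOn u (Set.Ioi 0) := fun x hx => (hu x hx).continuousAt.continuousWithinAt
  obtain ⟨A, hA⟩ := lim_aux u (fun x => - sin x) (fun x => u x * cos x - v x * sin x) m C hC huc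
    (by fun_prop) (fun x => by rw [abs_neg]; exact abs_sin_le_one x) (by
      intro x hx
      refine (((hu x hx).mul (hasDerivAt_cos x)).sub ((hv x hx).mul (hasDerivAt_sin x))).congr_deriv ?_
      ring)
  obtain ⟨B, hB⟩ := lim_aux u (fun x => cos x) (fun x => u x * sin x + v x * cos x) m C hC huc
    (by fun_prop) (fun x => abs_cos_le_one x) (by
      intro x hx
      refine (((hu x hx).mul (hasDerivAt_sin x)).add ((hv x hx).mul (hasDerivAt_cos x))).congr_deriv ?_
      ring)
  refine ⟨A, B, C, ?_, hC, ?_⟩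
  · have hlim := (hA.pow 2).add (hB.pow 2)
    have : (u 1 ^ 2 + v 1 ^ 2) * exp (-|m|) ≤ A ^ 2 + B ^ 2 := by
      refine ge_of_tendsto hlim ?_
      filter_upwards [eventually_ge_atTop 1] with x hx
      refine (hlo x hx).trans (le_of_eq ?_)
      have := sin_sq_add_cos_sq x
      linear_combination (-(u x ^ 2 + v x ^ 2)) * this
    exact lt_of_lt_of_le (by positivity) this
  · have hA' : Tendsto (fun x => (u x * cos x - v x * sin x - A) * cos x) atTop (𝓝 0) := by
      refine bdd_le_mul_tendsto_zero' 1 (Eventually.of_forall fun x => abs_cos_le_one x) ?_ |>.congr (fun x => mul_comm _ _)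
      simpa using hA.sub_const A
    have hB' : Tendsto (fun x => (u x * sin x + v x * cos x - B) * sin x) atTop (𝓝 0) := by
      refine bdd_le_mul_tendsto_zero' 1 (Eventually.of_forall fun x => abs_sin_le_one x) ?_ |>.congr (fun x => mul_comm _ _)
      simpa using hB.sub_const B
    have := hA'.add hB'
    rw [add_zero] at this
    refine this.congr (fun x => ?_)
    have := sin_sq_add_cos_sq x
    linear_combination (u x) * this

lemma cont_rpow_pos (s : ℝ) : ContinuousOn (fun z : ℝ => z ^ s) (Set.Ioi 0) :=
  fun _ hz => (Real.continuousAt_rpow_const _ _ (Or.inl (ne_of_gt hz))).continuousWithinAt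

lemma intble_of_cont {h : ℝ → ℝ} (hc : ContinuousOn h (Set.Ioi 0)) {a b : ℝ} (ha : 0 < a) (hb : 0 < b) :
    IntervalIntegrable h volume a b := by
  apply (hc.mono _).intervalIntegrable
  intro x hx
  exact lt_of_lt_of_le (lt_min ha hb) hx.1

lemma littleo_int (s : ℝ) (hs : -1 < s) (h : ℝ → ℝ) (hc : ContinuousOn h (Set.Ioi 0))
    (hl : Tendsto h atTop (𝓝 0)) :
    Tendsto (fun X : ℝ => (∫ z in (1 : ℝ)..X, z ^ s * h z) / X ^ (s + 1)) atTop (𝓝 0) := by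
  have hs1 : 0 < s + 1 := by linarith
  have hci := (cont_rpow_pos s).mul hc
  rw [Metric.tendsto_atTop]
  intro ε hε
  rw [Metric.tendsto_atTop] at hl
  obtain ⟨N, hN⟩ := hl (ε * (s + 1) / 2) (by positivity)
  set K := max N 1 with hK
  have hK1 : 1 ≤ K := le_max_right _ _
  have hK0 : 0 < K := by linarith
  set D := |∫ z in (1 : ℝ)..K, z ^ s * h z| with hD
  have ht : Tendsto (fun X : ℝ => D / X ^ (s + 1)) atTop (𝓝 0) :=
    tendsto_const_nhds.div_atTop (tendsto_rpow_atTop hs1)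
  rw [Metric.tendsto_atTop] at ht
  obtain ⟨N2, hN2⟩ := ht (ε / 2) (by positivity)
  refine ⟨max N2 K, fun X hX => ?_⟩
  have hXK : K ≤ X := (le_max_right _ _).trans hX
  have hX0 : 0 < X := by linarith
  have hXp : 0 < X ^ (s + 1) := Real.rpow_pos_of_pos hX0 _
  have h1 := hN2 X ((le_max_left _ _).trans hX)
  rw [Real.dist_eq, sub_zero] at h1
  have h1' := (abs_lt.1 h1).2
  rw [Real.dist_eq, sub_zero, abs_div, abs_of_pos hXp, div_lt_iff₀ hXp]
  rw [div_lt_iff₀ hXp] at h1'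
  have hsplit := intervalIntegral.integral_add_adjacent_intervals
    (intble_of_cont hci one_pos hK0) (intble_of_cont hci hK0 hX0)
  have htail : ‖∫ z in K..X, z ^ s * h z‖ ≤ ∫ z in K..X, (ε * (s + 1) / 2) * z ^ s := by
    apply intervalIntegral.norm_integral_le_of_norm_le hXK
    · refine Eventually.of_forall fun t ht => ?_
      have ht0 : 0 < t := hK0.trans ht.1
      have := hN t ((le_max_left _ _).trans ht.1.le)
      rw [Real.dist_eq, sub_zero] at this
      rw [norm_mul, Real.norm_eq_abs, Real.norm_eq_abs, abs_of_pos (Real.rpow_pos_of_pos ht0 _), mul_comm]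
      exact mul_le_mul_of_nonneg_right this.le (Real.rpow_nonneg ht0.le _)
    · exact (intble_of_cont (cont_rpow_pos s) hK0 hX0).const_mul _
  rw [intervalIntegral.integral_const_mul, integral_rpow (Or.inl hs), Real.norm_eq_abs] at htail
  have hKp : 0 < K ^ (s + 1) := Real.rpow_pos_of_pos hK0 _
  have htail2 : ε * (s + 1) / 2 * ((X ^ (s + 1) - K ^ (s + 1)) / (s + 1)) ≤ ε / 2 * X ^ (s + 1) := by
    have : ε * (s + 1) / 2 * ((X ^ (s + 1) - K ^ (s + 1)) / (s + 1)) = ε / 2 * (X ^ (s + 1) - K ^ (s + 1)) := by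
      field_simp
    rw [this]
    nlinarith
  simp only [Pi.mul_apply] at hsplit
  rw [← hsplit]
  refine (abs_add_le _ _).trans_lt ?_
  linarith

lemma avg_int (s : ℝ) (hs : -1 < s) (w f : ℝ → ℝ) (T : ℝ) (hT : 0 < T)
    (hwc : ContinuousOn w (Set.Ioi 0)) (hf : Continuous f) (hper : Function.Periodic f T)
    (hl : Tendsto (fun x => w x - f x) atTop (𝓝 0)) :
    Tendsto (fun X : ℝ => (∫ z in (1 : ℝ)..X, z ^ s * w z) / X ^ (s + 1)) atTop
      (𝓝 ((∫ z in (0 : ℝ)..T, f z) / T / (s + 1))) := by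
  have hs1 : 0 < s + 1 := by linarith
  set M := (∫ z in (0 : ℝ)..T, f z) / T with hM
  set F : ℝ → ℝ := fun x => ∫ z in (0 : ℝ)..x, (f z - M) with hF
  have hfM : Continuous (fun z => f z - M) := by fun_prop
  have hFd : ∀ x, HasDerivAt F (f x - M) x := fun x =>
    intervalIntegral.integral_hasDerivAt_right (hfM.intervalIntegrable _ _)
      (hfM.stronglyMeasurableAtFilter _ _) hfM.continuousAt
  have hFc : Continuous F := continuous_iff_continuousAt.2 fun x => (hFd x).continuousAt
  have hFper : Function.Periodic F T := by
    intro x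
    have e1 : F (x + T) = F x + ∫ z in x..(x + T), (f z - M) :=
      (intervalIntegral.integral_add_adjacent_intervals (hfM.intervalIntegrable _ _)
        (hfM.intervalIntegrable _ _)).symm
    have e2 : ∫ z in x..(x + T), (f z - M) = 0 := by
      rw [intervalIntegral.integral_sub (hf.intervalIntegrable _ _) (by simp),
        hper.intervalIntegral_add_eq x 0]
      simp [hM]
      field_simp
      simp
    rw [e1, e2, add_zero]
  obtain ⟨C, hC⟩ : ∃ C, ∀ x, |F x| ≤ C := by
    obtain ⟨C, hC⟩ := (hFper.isBounded_of_continuous hT.ne' hFc).exists_norm_le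
    exact ⟨C, fun x => hC _ ⟨x, rfl⟩⟩
  have hFx : Tendsto (fun x => F x / x) atTop (𝓝 0) := by
    have := bdd_le_mul_tendsto_zero' C (Eventually.of_forall hC) tendsto_inv_atTop_zero
    simpa only [div_eq_mul_inv] using this
  have hcx : ContinuousOn (fun x => F x / x) (Set.Ioi 0) :=
    hFc.continuousOn.div continuousOn_id (fun x hx => ne_of_gt hx)
  have l1 := littleo_int s hs _ (hwc.sub hf.continuousOn) hl
  have l2 := littleo_int s hs _ hcx hFx
  have l3 : Tendsto (fun X : ℝ => F 1 / X ^ (s + 1)) atTop (𝓝 0) :=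
    tendsto_const_nhds.div_atTop (tendsto_rpow_atTop hs1)
  have l4 : Tendsto (fun X : ℝ => M / (s + 1) / X ^ (s + 1)) atTop (𝓝 0) :=
    tendsto_const_nhds.div_atTop (tendsto_rpow_atTop hs1)
  have hlim : Tendsto (fun X : ℝ => (∫ z in (1 : ℝ)..X, z ^ s * (w z - f z)) / X ^ (s + 1)
      + (F X / X - F 1 / X ^ (s + 1) - s * ((∫ z in (1 : ℝ)..X, z ^ s * (F z / z)) / X ^ (s + 1)))
      + (M / (s + 1) - M / (s + 1) / X ^ (s + 1))) atTop (𝓝 (M / (s + 1))) := by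
    have := (l1.add ((hFx.sub l3).sub (l2.const_mul s))).add (l4.const_sub (M / (s + 1)))
    simpa using this
  refine hlim.congr' ?_
  filter_upwards [eventually_ge_atTop 1] with X hX
  have hX0 : 0 < X := by linarith
  have hXp : 0 < X ^ (s + 1) := Real.rpow_pos_of_pos hX0 _
  have hpos : ∀ x ∈ Set.uIcc 1 X, 0 < x := by
    intro x hx
    rw [Set.uIcc_of_le hX] at hx
    linarith [hx.1]
  have hparts := intervalIntegral.integral_mul_deriv_eq_deriv_mul (a := 1) (b := X)
    (u := fun z : ℝ => z ^ s) (u' := fun z : ℝ => s * z ^ (s - 1)) (v := F) (v' := fun z => f z - M)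
    (fun x hx => Real.hasDerivAt_rpow_const (Or.inl (hpos x hx).ne')) (fun x _ => hFd x)
    ((intble_of_cont (cont_rpow_pos _) one_pos hX0).const_mul s) (hfM.intervalIntegrable _ _)
  have e3 : ∫ z in (1 : ℝ)..X, s * z ^ (s - 1) * F z = s * ∫ z in (1 : ℝ)..X, z ^ s * (F z / z) := by
    rw [← intervalIntegral.integral_const_mul]
    apply intervalIntegral.integral_congr
    intro z hz
    have := hpos z hz
    simp only
    rw [Real.rpow_sub_one this.ne']
    ring
  rw [e3] at hparts
  simp only [Real.one_rpow, one_mul] at hparts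
  have ei1 : IntervalIntegrable (fun z : ℝ => z ^ s * (w z - f z)) volume 1 X :=
    intble_of_cont ((cont_rpow_pos s).mul (hwc.sub hf.continuousOn)) one_pos hX0
  have ei2 : IntervalIntegrable (fun z : ℝ => z ^ s * (f z - M)) volume 1 X :=
    intble_of_cont ((cont_rpow_pos s).mul hfM.continuousOn) one_pos hX0
  have ei3 : IntervalIntegrable (fun z : ℝ => M * z ^ s) volume 1 X :=
    (intble_of_cont (cont_rpow_pos s) one_pos hX0).const_mul M
  have e4 : ∫ z in (1 : ℝ)..X, z ^ s * w z = (∫ z in (1 : ℝ)..X, z ^ s * (w z - f z))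
      + (∫ z in (1 : ℝ)..X, z ^ s * (f z - M)) + ∫ z in (1 : ℝ)..X, M * z ^ s := by
    rw [← intervalIntegral.integral_add ei1 ei2, ← intervalIntegral.integral_add (ei1.add ei2) ei3]
    apply intervalIntegral.integral_congr
    intro z _
    simp only
    ring
  rw [intervalIntegral.integral_const_mul, integral_rpow (Or.inl hs), hparts, Real.one_rpow] at e4
  rw [e4]
  have hXs : X ^ (s + 1) = X ^ s * X := Real.rpow_add_one hX0.ne' s
  have hXsp : 0 < X ^ s := Real.rpow_pos_of_pos hX0 _
  rw [hXs]
  field_simp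

lemma ratio_lt (s R : ℝ) (hs : -1 < s) (hR : R ∈ Set.Ioo (0 : ℝ) 1) (q : ℝ → ℝ) (hq : Continuous q)
    (c : ℝ) (hc : 0 < c)
    (hl : Tendsto (fun X : ℝ => (∫ z in (1 : ℝ)..X, q z) / X ^ (s + 1)) atTop (𝓝 c)) :
    Tendsto (fun X : ℝ => (∫ z in (X * R)..X, q z) / ∫ z in (0 : ℝ)..X, q z) atTop
      (𝓝 (1 - R ^ (s + 1))) := by
  have hs1 : 0 < s + 1 := by linarith
  have l3 : Tendsto (fun X : ℝ => (∫ z in (0 : ℝ)..1, q z) / X ^ (s + 1)) atTop (𝓝 0) :=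
    tendsto_const_nhds.div_atTop (tendsto_rpow_atTop hs1)
  have hI : Tendsto (fun X : ℝ => (∫ z in (0 : ℝ)..X, q z) / X ^ (s + 1)) atTop (𝓝 c) := by
    have := l3.add hl
    rw [zero_add] at this
    refine this.congr (fun X => ?_)
    rw [← add_div, intervalIntegral.integral_add_adjacent_intervals (hq.intervalIntegrable _ _)
      (hq.intervalIntegrable _ _)]
  have hIR := hI.comp (tendsto_id.atTop_mul_const hR.1)
  have hRp : 0 < R ^ (s + 1) := Real.rpow_pos_of_pos hR.1 _
  have hfin := ((hI.sub (hIR.mul_const (R ^ (s + 1)))).div hI hc.ne')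
  have e : (c - c * R ^ (s + 1)) / c = 1 - R ^ (s + 1) := by field_simp
  rw [e] at hfin
  refine hfin.congr' ?_
  filter_upwards [eventually_gt_atTop 0] with X hX
  have hXp : 0 < X ^ (s + 1) := Real.rpow_pos_of_pos hX _
  have := intervalIntegral.integral_add_adjacent_intervals (hq.intervalIntegrable (μ := volume) 0 (X * R))
      (hq.intervalIntegrable (X * R) X)
  have e2 : (∫ z in (X * R)..X, q z) = (∫ z in (0 : ℝ)..X, q z) - ∫ z in (0 : ℝ)..(X * R), q z := by linarith
  rw [e2]
  simp only [Function.comp, id, Pi.div_apply]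
  rw [Real.mul_rpow hX.le hR.1.le]
  field_simp

lemma ratio_gt (R : ℝ) (hR : R ∈ Set.Ioo (0 : ℝ) 1) (q : ℝ → ℝ) (hq : Continuous q)
    (hq0 : ∀ z, 0 ≤ z → 0 ≤ q z) (hq1 : ∃ z, 0 < z ∧ 0 < q z)
    (hi : IntegrableOn q (Set.Ioi 1)) :
    Tendsto (fun X : ℝ => (∫ z in (X * R)..X, q z) / ∫ z in (0 : ℝ)..X, q z) atTop (𝓝 0) := by
  have hi0 : IntegrableOn q (Set.Ioi 0) := by
    rw [← Set.Ioc_union_Ioi_eq_Ioi (zero_le_one (α := ℝ))]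
    exact (hq.integrableOn_Ioc).union hi
  have hI := intervalIntegral_tendsto_integral_Ioi 0 hi0 tendsto_id
  simp only [id] at hI
  set L := ∫ z in Set.Ioi 0, q z
  have hL : 0 < L := by
    obtain ⟨z, hz, hqz⟩ := hq1
    have h1 : 0 < ∫ t in (0 : ℝ)..z, q t :=
      intervalIntegral.integral_pos hz hq.continuousOn (fun x hx => hq0 x hx.1.le)
        ⟨z, ⟨hz.le, le_rfl⟩, hqz⟩
    refine h1.trans_le (ge_of_tendsto hI ?_)
    filter_upwards [eventually_ge_atTop z] with X hX
    rw [← intervalIntegral.integral_add_adjacent_intervals (hq.intervalIntegrable 0 z)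
      (hq.intervalIntegrable z X)]
    have := intervalIntegral.integral_nonneg (μ := volume) hX (fun t ht => hq0 t (hz.le.trans ht.1))
    linarith
  have hIR := hI.comp (tendsto_id.atTop_mul_const hR.1)
  have hfin := ((hI.sub hIR).div hI hL.ne')
  rw [sub_self, zero_div] at hfin
  refine hfin.congr (fun X => ?_)
  have := intervalIntegral.integral_add_adjacent_intervals (hq.intervalIntegrable (μ := volume) 0 (X * R))
      (hq.intervalIntegrable (X * R) X)
  have e2 : (∫ z in (X * R)..X, q z) = (∫ z in (0 : ℝ)..X, q z) - ∫ z in (0 : ℝ)..(X * R), q z := by linarith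
  rw [e2]
  simp [Function.comp]

lemma abs_rpow_sub (p C : ℝ) (hp : 1 ≤ p) (u g : ℝ → ℝ) (hu : ∀ x, 1 ≤ x → |u x| ≤ C)
    (hg : ∀ x, |g x| ≤ C) (hl : Tendsto (fun x => u x - g x) atTop (𝓝 0)) :
    Tendsto (fun x => |u x| ^ p - |g x| ^ p) atTop (𝓝 0) := by
  have hc : Continuous (fun x : ℝ => |x| ^ p) := continuous_abs.rpow_const (fun x => Or.inr (by linarith))
  have huc := isCompact_Icc (a := -C) (b := C) |>.uniformContinuousOn_of_continuous hc.continuousOn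
  rw [Metric.uniformContinuousOn_iff] at huc
  rw [Metric.tendsto_atTop] at hl ⊢
  intro ε hε
  obtain ⟨δ, hδ, h⟩ := huc ε hε
  obtain ⟨N, hN⟩ := hl δ hδ
  refine ⟨max N 1, fun x hx => ?_⟩
  have h1 := hN x ((le_max_left _ _).trans hx)
  have := h (u x) (abs_le.1 (hu x ((le_max_right _ _).trans hx))) (g x) (abs_le.1 (hg x)) (by
    rw [Real.dist_eq]; rwa [Real.dist_eq, sub_zero] at h1)
  rwa [Real.dist_eq, sub_zero, ← Real.dist_eq]

lemma zJ_eq (n : ℕ) (p z : ℝ) (hz : 0 < z) :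
    z * |besselJ n z| ^ p = z ^ (1 - p / 2) * |bu n z| ^ p := by
  rw [besselJ_eq, bu, abs_mul, abs_of_nonneg (Real.sqrt_nonneg z),
    Real.mul_rpow (Real.sqrt_nonneg z) (abs_nonneg _), ← mul_assoc, Real.sqrt_eq_rpow,
    ← Real.rpow_mul hz.le, ← Real.rpow_add hz]
  have : 1 - p / 2 + 1 / 2 * p = 1 := by ring
  rw [this, Real.rpow_one]

lemma focus_lim (n : ℕ) (R p : ℝ) (hR : R ∈ Set.Ioo (0 : ℝ) 1) (hp : 1 ≤ p) :
    (p < 4 → Tendsto (fun X : ℝ => focusRatio n R p X) atTop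
        (𝓝 ((1 - R ^ (2 - p / 2)) ^ (1 / p))))
    ∧ (4 < p → Tendsto (fun X : ℝ => focusRatio n R p X) atTop (𝓝 0)) := by
  have hp0 : 0 < p := by linarith
  have hJc : Continuous (fun z : ℝ => besselJ n z) := by
    have : (fun z : ℝ => besselJ n z) = bJ n := funext (besselJ_eq n)
    rw [this]; exact bJ_continuous n
  have hqc : Continuous (fun z : ℝ => z * |besselJ n z| ^ p) :=
    continuous_id.mul (hJc.abs.rpow_const (fun x => Or.inr hp0.le))
  have hne : ∃ x, 0 < x ∧ bu n x ≠ 0 := by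
    obtain ⟨x, hx, hx'⟩ := bJ_ne n
    exact ⟨x, hx, mul_ne_zero (Real.sqrt_pos.2 hx).ne' hx'⟩
  obtain ⟨A, B, C, hAB, hC, hlim⟩ := osc_asymp (bu n) (bv n) _ (bu_deriv n) (bv_deriv n) hne
  have huc : ContinuousOn (bu n) (Set.Ioi 0) :=
    fun x hx => (bu_deriv n x hx).continuousAt.continuousWithinAt
  have hwc : ContinuousOn (fun x => |bu n x| ^ p) (Set.Ioi 0) :=
    huc.abs.rpow_const (fun x _ => Or.inr hp0.le)
  constructor
  · intro hp4
    have hg : ∀ x, |A * cos x + B * sin x| ≤ max C (|A| + |B|) := by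
      intro x
      refine le_trans ?_ (le_max_right _ _)
      refine (abs_add_le _ _).trans ?_
      rw [abs_mul, abs_mul]
      exact add_le_add (mul_le_of_le_one_right (abs_nonneg _) (abs_cos_le_one x))
        (mul_le_of_le_one_right (abs_nonneg _) (abs_sin_le_one x))
    have hsub := abs_rpow_sub p (max C (|A| + |B|)) hp (bu n) (fun x => A * cos x + B * sin x)
      (fun x hx => (hC x hx).trans (le_max_left _ _)) hg hlim
    have hfc : Continuous (fun x : ℝ => |A * cos x + B * sin x| ^ p) := by
      refine Continuous.rpow_const (by fun_prop) (fun x => Or.inr hp0.le)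
    have hs : -1 < 1 - p / 2 := by linarith
    have havg := avg_int (1 - p / 2) hs (fun x => |bu n x| ^ p) (fun x => |A * cos x + B * sin x| ^ p)
      (2 * π) (by positivity) hwc hfc (fun x => by simp) hsub
    have hpos : 0 < (∫ z in (0 : ℝ)..2 * π, |A * cos z + B * sin z| ^ p) := by
      apply intervalIntegral.integral_pos (by positivity) hfc.continuousOn (fun x _ => by positivity)
      by_cases hA : A = 0
      · have hB : B ≠ 0 := by
          rintro rfl; simp [hA] at hAB
        refine ⟨π / 2, ⟨by positivity, by linarith [Real.pi_pos]⟩, ?_⟩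
        simp only [cos_pi_div_two, sin_pi_div_two, mul_zero, zero_add, mul_one]
        exact Real.rpow_pos_of_pos (abs_pos.2 hB) _
      · refine ⟨0, ⟨le_rfl, by positivity⟩, ?_⟩
        simp only [cos_zero, sin_zero, mul_zero, add_zero, mul_one]
        exact Real.rpow_pos_of_pos (abs_pos.2 hA) _
    have hs1 : 0 < 1 - p / 2 + 1 := by linarith
    have hr := ratio_lt (1 - p / 2) R hs hR (fun z : ℝ => z * |besselJ n z| ^ p) hqc _
      (div_pos (div_pos hpos (by positivity : (0 : ℝ) < 2 * π)) hs1) (havg.congr' (by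
        filter_upwards [eventually_ge_atTop 1] with X hX
        congr 1
        apply intervalIntegral.integral_congr
        intro z hz
        rw [Set.uIcc_of_le hX] at hz
        exact (zJ_eq n p z (by linarith [hz.1])).symm))
    have e : 1 - p / 2 + 1 = 2 - p / 2 := by ring
    rw [e] at hr
    exact hr.rpow_const (Or.inr (by positivity))
  · intro hp4
    have hr := ratio_gt R hR (fun z : ℝ => z * |besselJ n z| ^ p) hqc (fun z hz => by positivity) (by
        obtain ⟨x, hx, hx'⟩ := bJ_ne n
        refine ⟨x, hx, ?_⟩
        rw [besselJ_eq]
        have := abs_pos.2 hx'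
        positivity) (by
      have hb : IntegrableOn (fun x : ℝ => C ^ p * x ^ (1 - p / 2)) (Set.Ioi 1) :=
        (integrableOn_Ioi_rpow_of_lt (by linarith) one_pos).const_mul _
      refine Integrable.mono' hb hqc.aestronglyMeasurable ?_
      refine (ae_restrict_iff' measurableSet_Ioi).2 (Eventually.of_forall fun x hx => ?_)
      have hx0 : (0 : ℝ) < x := lt_trans one_pos hx
      rw [zJ_eq n p x hx0, Real.norm_eq_abs, abs_of_nonneg (by positivity), mul_comm]
      have := hC x (le_of_lt hx)
      gcongr)
    have := hr.rpow_const (p := 1 / p) (Or.inr (by positivity))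
    rwa [Real.zero_rpow (by positivity)] at this

lemma zeros_atTop (n : ℕ) (α : ℕ → ℝ)
    (hα_pos : ∀ k : ℕ, 1 ≤ k → 0 < α k)
    (hα_zero : ∀ k : ℕ, 1 ≤ k → besselJ n (α k) = 0)
    (hα_mono : ∀ k l : ℕ, 1 ≤ k → k < l → α k < α l) : Tendsto α atTop atTop := by
  have hne : ∃ x, 0 < x ∧ bu n x ≠ 0 := by
    obtain ⟨x, hx, hx'⟩ := bJ_ne n
    exact ⟨x, hx, mul_ne_zero (Real.sqrt_pos.2 hx).ne' hx'⟩
  rw [← tendsto_add_atTop_iff_nat 1]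
  have hmono : StrictMono (fun k => α (k + 1)) := fun a b hab => hα_mono _ _ (by omega) (by omega)
  rcases tendsto_atTop_of_monotone hmono.monotone with h | ⟨c, hc⟩
  · exact h
  exfalso
  have hlt : ∀ k, α (k + 1) < c := fun k =>
    (hmono (Nat.lt_succ_self k)).trans_le (hmono.monotone.ge_of_tendsto hc (k + 1))
  have hc0 : 0 < c := (hα_pos 1 le_rfl).trans (hlt 0)
  have hz : ∀ k, bu n (α (k + 1)) = 0 := by
    intro k
    have := hα_zero (k + 1) (by omega)
    rw [besselJ_eq] at this
    rw [bu, this, mul_zero]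
  have hcz : bu n c = 0 := by
    have h1 := (bu_deriv n c hc0).continuousAt.tendsto.comp hc
    have h2 : (bu n ∘ fun k => α (k + 1)) = fun _ => 0 := funext hz
    rw [h2] at h1
    exact tendsto_nhds_unique h1 tendsto_const_nhds
  have hE := energy_pos (bu n) (bv n) _ (bu_deriv n) (bv_deriv n) hne c hc0
  have hv : bv n c ≠ 0 := by
    intro h; simp [hcz, h] at hE
  have hev := (bu_deriv n c hc0).eventually_ne (c := 0) hv
  have hc' : Tendsto (fun k => α (k + 1)) atTop (𝓝[≠] c) :=
    tendsto_nhdsWithin_iff.2 ⟨hc, Eventually.of_forall fun k => (hlt k).ne⟩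
  obtain ⟨k, hk⟩ := (hc'.eventually hev).exists
  exact hk (hz k)

theorem focusing_modes_disk
    (n : ℕ) (R p : ℝ) (hR : R ∈ Set.Ioo (0 : ℝ) 1) (hp : 1 ≤ p) (hp4 : p ≠ 4)
    (α : ℕ → ℝ)
    (hα_pos : ∀ k : ℕ, 1 ≤ k → 0 < α k)
    (hα_zero : ∀ k : ℕ, 1 ≤ k → besselJ n (α k) = 0)
    (hα_mono : ∀ k l : ℕ, 1 ≤ k → k < l → α k < α l)
    (hα_surj : ∀ x : ℝ, 0 < x → besselJ n x = 0 → ∃ k, 1 ≤ k ∧ α k = x) :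
    (p < 4 → Tendsto (fun k : ℕ => focusRatio n R p (α k)) atTop
        (𝓝 ((1 - R ^ (2 - p / 2)) ^ (1 / p))))
    ∧ (4 < p → Tendsto (fun k : ℕ => focusRatio n R p (α k)) atTop (𝓝 0)) := by
  have hT := zeros_atTop n α hα_pos hα_zero hα_mono
  obtain ⟨h1, h2⟩ := focus_lim n R p hR hp
  exact ⟨fun h => (h1 h).comp hT, fun h => (h2 h).comp hT⟩
end

section
/- Let d ≥ 1 be an integer and ℓ_1, …, ℓ_d > 0 reals such that ℓ_i²/ℓ_j² is irrational for all i ≠ j, and let Ω = (0,ℓ_1) × … × (0,ℓ_d) ⊂ ℝ^d. For positive integers n_1, …, n_d define u_{n_1,…,n_d}(x_1,…,x_d) = ∏_{i=1}^d sin(π n_i x_i / ℓ_i) (under the stated irrationality condition these are, up to scalar multiples, all the Dirichlet Laplacian eigenfunctions of Ω). Then for every real p ≥ 1 and every nonempty open set V ⊆ Ω, the infimum over all multi-indices (n_1,…,n_d) of ‖u_{n_1,…,n_d}‖_{L_p(V)} / ‖u_{n_1,…,n_d}‖_{L_p(Ω)} is strictly positive. In particular no Dirichlet eigenfunction of such a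 rectangle-like domain is L_p-localized. -/
open Real MeasureTheory Filter Topology

lemma aux_cont (p : ℝ) (hp : 1 ≤ p) (k : ℝ) : Continuous fun x : ℝ => |Real.sin (k * x)| ^ p :=
  Continuous.rpow_const (by fun_prop) (fun _ => Or.inr (by linarith))

lemma aux_pos (p : ℝ) (hp : 1 ≤ p) (a b : ℝ) (hab : a < b) (k : ℝ) (hk : 0 < k) :
    0 < ∫ x in a..b, |Real.sin (k * x)| ^ p := by
  have hne : ∃ c ∈ Set.Icc a b, Real.sin (k * c) ≠ 0 := by
    by_contra! h
    have h0 := h a ⟨le_rfl, hab.le⟩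
    have hη : 0 < min (b - a) (1 / k) := lt_min (by linarith) (by positivity)
    set η := min (b - a) (1 / k) with hηd
    have h1 := h (a + η) ⟨by linarith, by have := min_le_left (b - a) (1 / k); linarith⟩
    have h2 : k * η ≤ 1 := by
      have := mul_le_mul_of_nonneg_left (min_le_right (b - a) (1 / k)) hk.le
      rw [mul_one_div_cancel hk.ne'] at this
      exact this
    have h3 : 0 < Real.sin (k * η) :=
      Real.sin_pos_of_pos_of_lt_pi (by positivity) (by linarith [Real.pi_gt_three])
    rw [mul_add, Real.sin_add, h0] at h1
    have h4 : Real.cos (k * a) = 0 := by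
      have : Real.cos (k * a) * Real.sin (k * η) = 0 := by linarith
      exact (mul_eq_zero.mp this).resolve_right h3.ne'
    have := Real.sin_sq_add_cos_sq (k * a)
    rw [h0, h4] at this
    norm_num at this
  obtain ⟨c, hc, hs⟩ := hne
  refine intervalIntegral.integral_pos hab (aux_cont p hp k).continuousOn
    (fun x _ => by positivity) ⟨c, hc, ?_⟩
  have := abs_pos.mpr hs
  positivity

lemma aux_large (p : ℝ) (hp : 1 ≤ p) (a b : ℝ) (hab : a < b) (k : ℝ) (hk : 2 / (b - a) ≤ k) :
    (1 / 4 : ℝ) ^ p * ((b - a) / 8) ≤ ∫ x in a..b, |Real.sin (k * x)| ^ p := by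
  have hba : 0 < b - a := by linarith
  have hk0 : 0 < k := lt_of_lt_of_le (by positivity) hk
  have hpt : ∀ x, (1 / 4 : ℝ) ^ p * (Real.sin (k * x) ^ 2 - 1 / 16) ≤ |Real.sin (k * x)| ^ p := by
    intro x
    have hs1 := Real.sin_sq_le_one (k * x)
    have hq : (0 : ℝ) < (1 / 4 : ℝ) ^ p := by positivity
    rcases le_total (1 / 4) |Real.sin (k * x)| with h | h
    · have h1 : (1 / 4 : ℝ) ^ p ≤ |Real.sin (k * x)| ^ p :=
        Real.rpow_le_rpow (by norm_num) h (by linarith)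
      nlinarith
    · have h1 : 0 ≤ |Real.sin (k * x)| ^ p := by positivity
      have h2 : Real.sin (k * x) ^ 2 ≤ 1 / 16 := by
        rw [← sq_abs]; nlinarith [abs_nonneg (Real.sin (k * x))]
      nlinarith
  have hmono : ∫ x in a..b, (1 / 4 : ℝ) ^ p * (Real.sin (k * x) ^ 2 - 1 / 16)
      ≤ ∫ x in a..b, |Real.sin (k * x)| ^ p :=
    intervalIntegral.integral_mono_on hab.le
      (Continuous.intervalIntegrable (by fun_prop) _ _)
      ((aux_cont p hp k).intervalIntegrable _ _) (fun x _ => hpt x)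
  refine le_trans ?_ hmono
  rw [intervalIntegral.integral_const_mul]
  refine mul_le_mul_of_nonneg_left ?_ (by positivity)
  rw [intervalIntegral.integral_sub (Continuous.intervalIntegrable (by fun_prop) _ _)
    (by simp), intervalIntegral.integral_const,
    intervalIntegral.integral_comp_mul_left (fun x => Real.sin x ^ 2) hk0.ne', integral_sin_sq]
  simp only [smul_eq_mul]
  have e1 : ∀ t : ℝ, |Real.sin t * Real.cos t| ≤ 1 / 2 := by
    intro t
    rw [abs_le]
    constructor <;> nlinarith [Real.sin_sq_add_cos_sq t, sq_nonneg (Real.sin t + Real.cos t),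
      sq_nonneg (Real.sin t - Real.cos t)]
  have ea := abs_le.mp (e1 (k * a))
  have eb := abs_le.mp (e1 (k * b))
  have hkb : 2 ≤ k * (b - a) := by
    rwa [div_le_iff₀ hba] at hk
  have : k⁻¹ * ((k * (b - a) - 1) / 2) ≤ k⁻¹ * ((Real.sin (k * a) * Real.cos (k * a) -
      Real.sin (k * b) * Real.cos (k * b) + k * b - k * a) / 2) := by
    refine mul_le_mul_of_nonneg_left ?_ (by positivity)
    linarith [ea.1, eb.2]
  have h5 : (b - a) / 4 ≤ k⁻¹ * ((k * (b - a) - 1) / 2) := by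
    rw [inv_mul_eq_div, le_div_iff₀ hk0]
    linarith
  linarith

lemma aux_unif (p : ℝ) (hp : 1 ≤ p) (a b : ℝ) (hab : a < b) (l : ℝ) (hl : 0 < l) :
    ∃ c > 0, ∀ n : ℕ, 1 ≤ n → c ≤ ∫ x in Set.Ioo a b, |Real.sin (π * n * x / l)| ^ p := by
  have key : ∀ n : ℕ, ∫ x in Set.Ioo a b, |Real.sin (π * n * x / l)| ^ p
      = ∫ x in a..b, |Real.sin (π * n / l * x)| ^ p := by
    intro n
    rw [intervalIntegral.integral_of_le hab.le, integral_Ioc_eq_integral_Ioo]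
    congr 1; ext x; congr 3; ring
  simp only [key]
  obtain ⟨N, hN⟩ := exists_nat_ge (2 / (b - a) * l / π)
  have fin : ∀ M : ℕ, ∃ c > 0, ∀ n : ℕ, 1 ≤ n → n < M →
      c ≤ ∫ x in a..b, |Real.sin (π * n / l * x)| ^ p := by
    intro M
    induction M with
    | zero => exact ⟨1, one_pos, fun n _ h => by omega⟩
    | succ M ih =>
      obtain ⟨c, hc, h⟩ := ih
      rcases Nat.eq_zero_or_pos M with h0 | h0
      · exact ⟨1, one_pos, fun n _ h => by omega⟩
      · refine ⟨min c (∫ x in a..b, |Real.sin (π * M / l * x)| ^ p),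
          lt_min hc (aux_pos p hp a b hab _ ?_), fun n h1 h2 => ?_⟩
        · have : (0 : ℝ) < M := by exact_mod_cast h0
          positivity
        · rcases Nat.lt_succ_iff_lt_or_eq.mp h2 with h3 | rfl
          · exact (min_le_left _ _).trans (h n h1 h3)
          · exact min_le_right _ _
  obtain ⟨c, hc, h⟩ := fin N
  have hba : 0 < b - a := by linarith
  refine ⟨min c ((1 / 4 : ℝ) ^ p * ((b - a) / 8)), lt_min hc (by positivity), fun n h1 => ?_⟩
  rcases lt_or_ge n N with h2 | h2
  · exact (min_le_left _ _).trans (h n h1 h2)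
  · refine (min_le_right _ _).trans (aux_large p hp a b hab _ ?_)
    have : (N : ℝ) ≤ n := by exact_mod_cast h2
    have h3 := hN.trans this
    rw [div_le_iff₀ Real.pi_pos] at h3
    rw [le_div_iff₀ hl]
    linarith

theorem no_localization_rectangle_dirichlet
    (d : ℕ) (hd : 1 ≤ d) (ℓ : Fin d → ℝ) (hℓ : ∀ i, 0 < ℓ i)
    (hirr : ∀ i j : Fin d, i ≠ j → Irrational (ℓ i ^ 2 / ℓ j ^ 2))
    (p : ℝ) (hp : 1 ≤ p)
    (V : Set (Fin d → ℝ)) (hVopen : IsOpen V) (hVne : V.Nonempty)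
    (hVΩ : V ⊆ Set.univ.pi fun i => Set.Ioo 0 (ℓ i)) :
    0 < sInf {r : ℝ | ∃ n : Fin d → ℕ, (∀ i, 1 ≤ n i) ∧
      r = (∫ x in V, |∏ i, Real.sin (π * n i * x i / ℓ i)| ^ p) ^ (1 / p) /
          (∫ x in Set.univ.pi fun i => Set.Ioo 0 (ℓ i),
              |∏ i, Real.sin (π * n i * x i / ℓ i)| ^ p) ^ (1 / p)} := by
  obtain ⟨x₀, hx₀⟩ := hVne
  obtain ⟨r, hr, hball⟩ := Metric.isOpen_iff.mp hVopen x₀ hx₀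
  rw [ball_pi _ hr] at hball
  simp only [Real.ball_eq_Ioo] at hball
  set B : Set (Fin d → ℝ) := Set.univ.pi fun i => Set.Ioo (x₀ i - r) (x₀ i + r) with hB
  set Ω : Set (Fin d → ℝ) := Set.univ.pi fun i => Set.Ioo 0 (ℓ i) with hΩ
  have hu := fun i => aux_unif p hp (x₀ i - r) (x₀ i + r) (by linarith) (ℓ i) (hℓ i)
  choose c hc hcn using hu
  have hvol : volume Ω = ∏ i, ENNReal.ofReal (ℓ i) := by
    rw [hΩ, volume_pi_pi]; simp
  have hfin : volume Ω < ⊤ := by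
    rw [hvol]; exact ENNReal.prod_lt_top (fun i _ => ENNReal.ofReal_lt_top)
  have hreal : volume.real Ω = ∏ i, ℓ i := by
    rw [Measure.real, hvol, ENNReal.toReal_prod]
    exact Finset.prod_congr rfl fun i _ => ENNReal.toReal_ofReal (hℓ i).le
  have hL : 0 < ∏ i, ℓ i := Finset.prod_pos fun i _ => hℓ i
  have hC : 0 < ∏ i, c i := Finset.prod_pos fun i _ => hc i
  have hcont : ∀ n : Fin d → ℕ, Continuous fun x : Fin d → ℝ =>
      |∏ i, Real.sin (π * n i * x i / ℓ i)| ^ p := fun n =>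
    Continuous.rpow_const (by fun_prop) (fun _ => Or.inr (by linarith))
  have hle1 : ∀ (n : Fin d → ℕ) (x : Fin d → ℝ),
      ‖|∏ i, Real.sin (π * n i * x i / ℓ i)| ^ p‖ ≤ 1 := by
    intro n x
    rw [Real.norm_of_nonneg (by positivity)]
    refine Real.rpow_le_one (abs_nonneg _) ?_ (by linarith)
    rw [Finset.abs_prod]
    exact Finset.prod_le_one (fun _ _ => abs_nonneg _) (fun _ _ => Real.abs_sin_le_one _)
  have hint : ∀ n : Fin d → ℕ, IntegrableOn (fun x : Fin d → ℝ =>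
      |∏ i, Real.sin (π * n i * x i / ℓ i)| ^ p) Ω := fun n =>
    Measure.integrableOn_of_bounded hfin.ne (hcont n).aestronglyMeasurable
      (ae_of_all _ (hle1 n))
  have hup : ∀ n : Fin d → ℕ,
      ∫ x in Ω, |∏ i, Real.sin (π * n i * x i / ℓ i)| ^ p ≤ ∏ i, ℓ i := by
    intro n
    have := norm_setIntegral_le_of_norm_le_const (μ := volume) hfin (fun x _ => hle1 n x)
    rw [one_mul, hreal] at this
    exact (le_abs_self _).trans this
  have hlowB : ∀ n : Fin d → ℕ, (∀ i, 1 ≤ n i) →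
      ∏ i, c i ≤ ∫ x in B, |∏ i, Real.sin (π * n i * x i / ℓ i)| ^ p := by
    intro n hn
    have e : ∫ x in B, |∏ i, Real.sin (π * n i * x i / ℓ i)| ^ p
        = ∏ i, ∫ x in Set.Ioo (x₀ i - r) (x₀ i + r), |Real.sin (π * n i * x / ℓ i)| ^ p := by
      rw [hB, volume_pi, Measure.restrict_pi_pi,
        ← integral_fintype_prod_eq_prod (fun i x => |Real.sin (π * n i * x / ℓ i)| ^ p)]
      congr 1; ext x
      rw [Finset.abs_prod, Real.finset_prod_rpow _ _ (fun _ _ => abs_nonneg _)]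
    rw [e]
    exact Finset.prod_le_prod (fun i _ => (hc i).le) (fun i _ => hcn i (n i) (hn i))
  have hlow : ∀ n : Fin d → ℕ, (∀ i, 1 ≤ n i) →
      ∏ i, c i ≤ ∫ x in V, |∏ i, Real.sin (π * n i * x i / ℓ i)| ^ p := fun n hn =>
    (hlowB n hn).trans (setIntegral_mono_set ((hint n).mono_set hVΩ)
      (ae_of_all _ fun x => by simp only [Pi.zero_apply]; positivity) hball.eventuallyLE)
  have hVO : ∀ n : Fin d → ℕ,
      ∫ x in V, |∏ i, Real.sin (π * n i * x i / ℓ i)| ^ p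
        ≤ ∫ x in Ω, |∏ i, Real.sin (π * n i * x i / ℓ i)| ^ p := fun n =>
    setIntegral_mono_set (hint n)
      (ae_of_all _ fun x => by simp only [Pi.zero_apply]; positivity) hVΩ.eventuallyLE
  have hp' : 0 ≤ 1 / p := by positivity
  refine lt_of_lt_of_le (b := (∏ i, c i) ^ (1 / p) / (∏ i, ℓ i) ^ (1 / p)) (by positivity) ?_
  refine le_csInf ⟨_, fun _ => 1, fun _ => le_rfl, rfl⟩ ?_
  rintro _ ⟨n, hn, rfl⟩
  have h1 := hlow n hn
  have h2 : 0 < ∫ x in Ω, |∏ i, Real.sin (π * n i * x i / ℓ i)| ^ p :=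
    hC.trans_le (h1.trans (hVO n))
  exact div_le_div₀ (Real.rpow_nonneg (hC.le.trans h1) _) (Real.rpow_le_rpow hC.le h1 hp')
    (Real.rpow_pos_of_pos h2 _) (Real.rpow_le_rpow h2.le (hup n) hp')
end

section
/- Let 0 ≤ a < b be reals and define ε(a,b) = min{ (b−a)/4, min_{n = 1,…,⌊2/(b−a)⌋} ( (b−a)/2 − |sin(n(b−a))|/(2n) ) } (where the inner minimum over an empty range is by convention +∞, so that ε(a,b) = (b−a)/4 when b−a > 2). Then ε(a,b) > 0, and for every positive integer m: ∫_a^b |sin(mx)| dx ≥ ∫_a^b sin²(mx) dx ≥ ε(a,b) and ∫_a^b |cos(mx)| dx ≥ ∫_a^b cos²(mx) dx ≥ ε(a,b). In particular the lower bound ε(a,b) does not depend on m. -/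
open Real MeasureTheory intervalIntegral

/-- `ε(a,b) = min{ (b−a)/4, min_{n=1,…,⌊2/(b−a)⌋} ((b−a)/2 − |sin(n(b−a))|/(2n)) }`,
with the inner minimum over an empty range taken as `+∞` (i.e. dropped). -/
noncomputable def epsLB (a b : ℝ) : ℝ :=
  if h : (Finset.Icc 1 (Nat.floor (2 / (b - a)))).Nonempty then
    min ((b - a) / 4)
      ((Finset.Icc 1 (Nat.floor (2 / (b - a)))).inf' h
        fun n => (b - a) / 2 - |Real.sin (n * (b - a))| / (2 * n))
  else (b - a) / 4

lemma aux_eps_le (a b : ℝ) (hab : a < b) (m : ℕ) (hm : 1 ≤ m) :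
    epsLB a b ≤ (b - a) / 2 - |Real.sin (m * (b - a))| / (2 * m) := by
  have hd : 0 < b - a := sub_pos.mpr hab
  have hm0 : (0 : ℝ) < m := by exact_mod_cast hm
  by_cases hmem : m ≤ Nat.floor (2 / (b - a))
  · have hM : m ∈ Finset.Icc 1 (Nat.floor (2 / (b - a))) := Finset.mem_Icc.mpr ⟨hm, hmem⟩
    have hne : (Finset.Icc 1 (Nat.floor (2 / (b - a)))).Nonempty := ⟨m, hM⟩
    unfold epsLB
    rw [dif_pos hne]
    exact (min_le_right _ _).trans
      (Finset.inf'_le (fun n : ℕ => (b - a) / 2 - |Real.sin (n * (b - a))| / (2 * n)) hM)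
  · have h1 : epsLB a b ≤ (b - a) / 4 := by
      unfold epsLB
      split_ifs
      · exact min_le_left _ _
      · exact le_rfl
    have h2 : 2 / (b - a) < m := Nat.lt_of_floor_lt (not_le.mp hmem)
    rw [div_lt_iff₀ hd] at h2
    have h3 : |Real.sin (m * (b - a))| / (2 * m) ≤ (b - a) / 4 := by
      rw [div_le_iff₀ (by positivity)]
      have := Real.abs_sin_le_one (m * (b - a))
      nlinarith
    linarith

lemma aux_eps_pos (a b : ℝ) (hab : a < b) : 0 < epsLB a b := by
  have hd : 0 < b - a := sub_pos.mpr hab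
  unfold epsLB
  split_ifs with h
  · refine lt_min (by linarith) ?_
    rw [Finset.lt_inf'_iff]
    intro n hn
    have hn0 : (0 : ℝ) < n := by exact_mod_cast (Finset.mem_Icc.mp hn).1
    have hp : 0 < (n : ℝ) * (b - a) := mul_pos hn0 hd
    have h1 : |Real.sin (n * (b - a))| < n * (b - a) := by
      have := Real.abs_sin_lt_abs hp.ne'
      rwa [abs_of_pos hp] at this
    rw [sub_pos, div_lt_iff₀ (by positivity)]
    linarith
  · linarith

lemma aux_integral (a b s : ℝ) (m : ℕ) (hm : 1 ≤ m) (hs : |s| = 1) :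
    (b - a) / 2 - |Real.sin (m * (b - a))| / (2 * m) ≤
      ∫ x in a..b, (1 / 2 - s * Real.cos (2 * (m * x)) / 2) := by
  have hm0 : (0 : ℝ) < m := by exact_mod_cast hm
  have hI : ∫ x in a..b, (1 / 2 - s * Real.cos (2 * (m * x)) / 2) =
      (b / 2 - s * Real.sin (2 * (m * b)) / (4 * m))
        - (a / 2 - s * Real.sin (2 * (m * a)) / (4 * m)) := by
    refine integral_eq_sub_of_hasDerivAt
      (f := fun x => x / 2 - s * Real.sin (2 * (m * x)) / (4 * m)) ?_ ?_
    · intro x _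
      have h0 : HasDerivAt (fun x : ℝ => 2 * ((m : ℝ) * x)) (2 * (m * 1)) x :=
        ((hasDerivAt_id x).const_mul (m : ℝ)).const_mul 2
      have h := ((hasDerivAt_id x).div_const 2).sub ((h0.sin.const_mul s).div_const (4 * (m : ℝ)))
      refine HasDerivAt.congr_deriv h ?_
      field_simp
      ring
    · exact Continuous.intervalIntegrable (by fun_prop) _ _
  have hsin : Real.sin (2 * (m * b)) - Real.sin (2 * (m * a)) =
      2 * Real.sin (m * (b - a)) * Real.cos (m * (a + b)) := by
    rw [Real.sin_sub_sin]
    congr 2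
    · congr 1; ring_nf
    · ring
  have hb : s * Real.cos (m * (a + b)) * Real.sin (m * (b - a)) ≤ |Real.sin (m * (b - a))| := by
    refine (le_abs_self _).trans ?_
    rw [abs_mul, abs_mul, hs, one_mul]
    exact mul_le_of_le_one_left (abs_nonneg _) (Real.abs_cos_le_one _)
  have hE : (b / 2 - s * Real.sin (2 * (m * b)) / (4 * m))
        - (a / 2 - s * Real.sin (2 * (m * a)) / (4 * m)) =
      (b - a) / 2 - s * Real.cos (m * (a + b)) * Real.sin (m * (b - a)) / (2 * m) := by
    have : Real.sin (2 * (m * b)) = Real.sin (2 * (m * a)) +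
      2 * Real.sin (m * (b - a)) * Real.cos (m * (a + b)) := by linarith
    rw [this]
    field_simp
    ring
  rw [hI, hE]
  gcongr

lemma aux_sq_le (t : ℝ) (h : |t| ≤ 1) : t ^ 2 ≤ |t| := by
  rw [← sq_abs]
  nlinarith [abs_nonneg t]

theorem sin_cos_integral_lower_bound (a b : ℝ) (ha : 0 ≤ a) (hab : a < b) :
    0 < epsLB a b ∧
    ∀ m : ℕ, 1 ≤ m →
      ((∫ x in a..b, Real.sin (m * x) ^ 2) ≤ ∫ x in a..b, |Real.sin (m * x)|) ∧
      (epsLB a b ≤ ∫ x in a..b, Real.sin (m * x) ^ 2) ∧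
      ((∫ x in a..b, Real.cos (m * x) ^ 2) ≤ ∫ x in a..b, |Real.cos (m * x)|) ∧
      (epsLB a b ≤ ∫ x in a..b, Real.cos (m * x) ^ 2) := by
  refine ⟨aux_eps_pos a b hab, fun m hm => ⟨?_, ?_, ?_, ?_⟩⟩
  · refine integral_mono_on hab.le (Continuous.intervalIntegrable (by fun_prop) _ _)
      (Continuous.intervalIntegrable (by fun_prop) _ _) ?_
    exact fun x _ => aux_sq_le _ (Real.abs_sin_le_one _)
  · refine (aux_eps_le a b hab m hm).trans ((aux_integral a b 1 m hm (by simp)).trans_eq ?_)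
    congr 1
    funext x
    rw [Real.sin_sq_eq_half_sub]
    ring
  · refine integral_mono_on hab.le (Continuous.intervalIntegrable (by fun_prop) _ _)
      (Continuous.intervalIntegrable (by fun_prop) _ _) ?_
    exact fun x _ => aux_sq_le _ (Real.abs_cos_le_one _)
  · refine (aux_eps_le a b hab m hm).trans ((aux_integral a b (-1) m hm (by simp)).trans_eq ?_)
    congr 1
    funext x
    rw [Real.cos_sq]
    ring
end

section
/- For every integer n ≥ 1, the first positive zero j_{n,1} of the Bessel function J_n and the first positive zero j′_{n,1} of its derivative J_n′ satisfy n < j′_{n,1} < j_{n,1} < √(n+1) · (√(n+2) + 1). -/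
open Real

noncomputable def FF (n : ℕ) (t : ℝ) : ℝ :=
  ∑' k : ℕ, (-1 : ℝ) ^ k / ((k.factorial : ℝ) * ((k+n).factorial : ℝ)) * t ^ k

lemma FF_coef_bound (n k : ℕ) :
    |(-1 : ℝ) ^ k / ((k.factorial : ℝ) * ((k+n).factorial : ℝ))| ≤ 1 / (k.factorial : ℝ) := by
  rw [abs_div, abs_pow, abs_neg, abs_one, one_pow, abs_of_pos (by positivity)]
  apply one_div_le_one_div_of_le (by positivity)
  have : (1:ℝ) ≤ ((k+n).factorial : ℝ) := by exact_mod_cast Nat.factorial_pos _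
  have h2 : (0:ℝ) < (k.factorial : ℝ) := by positivity
  nlinarith

lemma FF_summable (n : ℕ) (t : ℝ) :
    Summable fun k : ℕ => (-1 : ℝ) ^ k / ((k.factorial : ℝ) * ((k+n).factorial : ℝ)) * t ^ k := by
  apply Summable.of_norm_bounded (Real.summable_pow_div_factorial |t|)
  intro k
  rw [norm_mul, Real.norm_eq_abs, Real.norm_eq_abs, abs_pow]
  have := mul_le_mul_of_nonneg_right (FF_coef_bound n k) (pow_nonneg (abs_nonneg t) k)
  refine this.trans (le_of_eq ?_)
  ring

lemma FF_zero (n : ℕ) : FF n 0 = 1 / (n.factorial : ℝ) := by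
  unfold FF
  rw [tsum_eq_single 0]
  · simp
  · intro k hk; simp [hk]

lemma FF_hasDerivAt (n : ℕ) (t : ℝ) : HasDerivAt (FF n) (-FF (n+1) t) t := by
  set M : ℝ := |t| + 1 with hM
  have hM0 : 0 ≤ M := by positivity
  have hu : Summable fun k : ℕ => (1 / (k.factorial : ℝ)) * (k * M ^ (k-1)) := by
    rw [← summable_nat_add_iff 1]
    refine (Real.summable_pow_div_factorial M).congr ?_
    intro k
    rw [Nat.factorial_succ]
    push_cast
    have : (k.factorial : ℝ) ≠ 0 := by positivity
    have : (k : ℝ) + 1 ≠ 0 := by positivity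
    field_simp
  have hmem : t ∈ Metric.ball (0:ℝ) M := by
    rw [Metric.mem_ball, dist_zero_right, Real.norm_eq_abs]; linarith
  have key := hasDerivAt_tsum_of_isPreconnected (𝕜 := ℝ) (F := ℝ) (t := Metric.ball (0:ℝ) M)
    (g := fun (k : ℕ) (s : ℝ) => (-1 : ℝ) ^ k / ((k.factorial : ℝ) * ((k+n).factorial : ℝ)) * s ^ k)
    (g' := fun (k : ℕ) (s : ℝ) => (-1 : ℝ) ^ k / ((k.factorial : ℝ) * ((k+n).factorial : ℝ)) * (k * s ^ (k-1)))
    (y₀ := 0) (y := t)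
    hu Metric.isOpen_ball (convex_ball _ _).isPreconnected
    (fun k s _ => (hasDerivAt_pow k s).const_mul _)
    (by
      intro k s hs
      rw [Metric.mem_ball, dist_zero_right, Real.norm_eq_abs] at hs
      rw [norm_mul, Real.norm_eq_abs]
      apply mul_le_mul (FF_coef_bound n k) _ (norm_nonneg _) (by positivity)
      rw [norm_mul, norm_pow, Real.norm_natCast, Real.norm_eq_abs]
      gcongr)
    (by rw [Metric.mem_ball, dist_self]; positivity)
    (FF_summable n 0) hmem
  have hterm : ∀ k : ℕ, (-1 : ℝ) ^ (k+1) / (((k+1).factorial : ℝ) * ((k+1+n).factorial : ℝ))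
      * (((k+1 : ℕ) : ℝ) * t ^ (k+1-1)) =
      -((-1 : ℝ) ^ k / ((k.factorial : ℝ) * ((k+(n+1)).factorial : ℝ)) * t ^ k) := by
    intro k
    rw [Nat.factorial_succ, show k + 1 + n = k + (n+1) by ring, Nat.add_sub_cancel]
    push_cast
    have : (k.factorial : ℝ) ≠ 0 := by positivity
    have : (k : ℝ) + 1 ≠ 0 := by positivity
    have : ((k+(n+1)).factorial : ℝ) ≠ 0 := by positivity
    field_simp
    ring
  refine key.congr_deriv ?_
  rw [← Summable.sum_add_tsum_nat_add' (k := 1)]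
  · simp only [Finset.range_one, Finset.sum_singleton, Nat.cast_zero, zero_mul, mul_zero, zero_add]
    unfold FF
    rw [← tsum_neg]
    exact tsum_congr hterm
  · exact (FF_summable (n+1) t).neg.congr fun k => (hterm k).symm

lemma FF_rec (n : ℕ) (t : ℝ) : FF n t = (n+1) * FF (n+1) t - t * FF (n+2) t := by
  have h1 := (FF_summable (n+1) t)
  have h2 := (FF_summable (n+2) t)
  have h0 := (FF_summable n t)
  unfold FF
  rw [h0.tsum_eq_zero_add, h1.tsum_eq_zero_add, mul_add, ← tsum_mul_left, ← tsum_mul_left,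
    add_sub_assoc, ← Summable.tsum_sub]
  · congr 1
    · simp [Nat.factorial_succ]
      have : (n.factorial : ℝ) ≠ 0 := by positivity
      have : (n : ℝ) + 1 ≠ 0 := by positivity
      field_simp
    · congr 1; ext k
      rw [show k + 1 + (n+1) = (k + 1 + n)+1 by ring, show k + (n+2) = (k + 1 + n)+1 by ring,
        Nat.factorial_succ, Nat.factorial_succ]
      push_cast
      have : (k.factorial : ℝ) ≠ 0 := by positivity
      have : (k : ℝ) + 1 ≠ 0 := by positivity
      have : ((k+1+n).factorial : ℝ) ≠ 0 := by positivity
      have : (k : ℝ) + 1 + n + 1 ≠ 0 := by positivity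
      field_simp
      ring
  · exact ((summable_nat_add_iff 1).2 h1).mul_left _
  · exact h2.mul_left _

lemma besselJ_eq_s12 (n : ℕ) (x : ℝ) : besselJ n x = (x/2)^n * FF n ((x/2)^2) := by
  unfold besselJ FF
  rw [← tsum_mul_left]
  congr 1; ext k
  rw [show (k:ℝ) + n + 1 = ((k+n : ℕ) : ℝ) + 1 by push_cast; ring, Real.Gamma_nat_eq_factorial,
    show 2 * (k:ℝ) + n = ((2*k+n : ℕ) : ℝ) by push_cast; ring, Real.rpow_natCast,
    pow_add, pow_mul]
  ring

/-- scaled Bessel function -/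
noncomputable def KK (n : ℕ) (r y : ℝ) : ℝ := (r*y)^n * FF n ((r*y)^2)
/-- y times its derivative -/
noncomputable def HH (n : ℕ) (r y : ℝ) : ℝ :=
  n * (r*y)^n * FF n ((r*y)^2) - 2 * (r*y)^(n+2) * FF (n+1) ((r*y)^2)

lemma pow_hasDerivAt' (n : ℕ) (r y : ℝ) (hy : y ≠ 0) :
    HasDerivAt (fun y => (r*y)^n) (n * (r*y)^n / y) y := by
  have := (((hasDerivAt_id' y).const_mul r).fun_pow n)
  refine this.congr_deriv ?_
  rcases n with _ | n
  · simp
  · rw [Nat.add_sub_cancel]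
    field_simp
    ring

lemma FF_comp_hasDerivAt (n : ℕ) (r y : ℝ) (hy : y ≠ 0) :
    HasDerivAt (fun y => FF n ((r*y)^2)) (-2 * (r*y)^2 * FF (n+1) ((r*y)^2) / y) y := by
  have := (FF_hasDerivAt n ((r*y)^2)).comp y (pow_hasDerivAt' 2 r y hy)
  refine this.congr_deriv ?_
  push_cast; ring

lemma KK_hasDerivAt (n : ℕ) (r y : ℝ) (hy : y ≠ 0) :
    HasDerivAt (KK n r) (HH n r y / y) y := by
  have := (pow_hasDerivAt' n r y hy).mul (FF_comp_hasDerivAt n r y hy)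
  refine this.congr_deriv ?_
  unfold HH; ring

lemma HH_hasDerivAt (n : ℕ) (r y : ℝ) (hy : y ≠ 0) :
    HasDerivAt (HH n r) ((n^2 - 4*r^2*y^2) * KK n r y / y) y := by
  have := (((pow_hasDerivAt' n r y hy).const_mul (n:ℝ)).mul (FF_comp_hasDerivAt n r y hy)).sub
    (((pow_hasDerivAt' (n+2) r y hy).const_mul 2).mul (FF_comp_hasDerivAt (n+1) r y hy))
  refine this.congr_deriv ?_
  unfold KK
  rw [FF_rec n]
  push_cast
  ring

lemma FF_cont (n : ℕ) : Continuous (FF n) :=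
  continuous_iff_continuousAt.2 fun t => (FF_hasDerivAt n t).continuousAt

lemma KK_cont (n : ℕ) (r : ℝ) : Continuous (KK n r) := by
  have := FF_cont n
  unfold KK; fun_prop
lemma HH_cont (n : ℕ) (r : ℝ) : Continuous (HH n r) := by
  have := FF_cont n
  have := FF_cont (n+1)
  unfold HH; fun_prop

lemma HH_zero (n : ℕ) (hn : 1 ≤ n) (r : ℝ) : HH n r 0 = 0 := by
  unfold HH
  simp [show n ≠ 0 by omega]

lemma KK_zero (n : ℕ) (hn : 1 ≤ n) (r : ℝ) : KK n r 0 = 0 := by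
  unfold KK
  simp [show n ≠ 0 by omega]

/-- Rolle for `HH`. -/
lemma HH_rolle (n : ℕ) (r a b : ℝ) (ha : 0 ≤ a) (hab : a < b) (h1 : HH n r a = 0)
    (h2 : HH n r b = 0) : ∃ c ∈ Set.Ioo a b, (n:ℝ)^2 = 4*r^2*c^2 ∨ KK n r c = 0 := by
  obtain ⟨c, hc, h⟩ := exists_hasDerivAt_eq_zero hab (HH_cont n r).continuousOn (h1.trans h2.symm)
    (fun x hx => HH_hasDerivAt n r x (by linarith [hx.1] : x > 0).ne')
  refine ⟨c, hc, ?_⟩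
  have hc0 : c ≠ 0 := (by linarith [hc.1] : c > 0).ne'
  rcases div_eq_zero_iff.1 h with h | h
  · rcases mul_eq_zero.1 h with h | h
    · left; linarith
    · right; exact h
  · exact absurd h hc0

lemma KK_rolle (n : ℕ) (r a b : ℝ) (ha : 0 ≤ a) (hab : a < b) (h1 : KK n r a = 0)
    (h2 : KK n r b = 0) : ∃ c ∈ Set.Ioo a b, HH n r c = 0 := by
  obtain ⟨c, hc, h⟩ := exists_hasDerivAt_eq_zero hab (KK_cont n r).continuousOn (h1.trans h2.symm)
    (fun x hx => KK_hasDerivAt n r x (by linarith [hx.1] : x > 0).ne')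
  refine ⟨c, hc, ?_⟩
  have hc0 : c ≠ 0 := (by linarith [hc.1] : c > 0).ne'
  rcases div_eq_zero_iff.1 h with h | h
  · exact h
  · exact absurd h hc0

lemma HH_one_ne (n : ℕ) (hn : 1 ≤ n) (r : ℝ) (hr : 0 < r) (hK1 : KK n r 1 = 0)
    (hne : ∀ y ∈ Set.Ioo (0:ℝ) 1, KK n r y ≠ 0) : HH n r 1 ≠ 0 := by
  intro h1
  obtain ⟨c, hc, h⟩ := KK_rolle n r 0 1 le_rfl one_pos (KK_zero n hn r) hK1
  obtain ⟨d, hd, h3⟩ := HH_rolle n r 0 c le_rfl hc.1 (HH_zero n hn r) h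
  obtain ⟨e, he, h4⟩ := HH_rolle n r c 1 hc.1.le hc.2 h h1
  have h3 := h3.resolve_right (hne d ⟨hd.1, hd.2.trans hc.2⟩)
  have h4 := h4.resolve_right (hne e ⟨hc.1.trans he.1, he.2⟩)
  have hde : d < e := hd.2.trans he.1
  have : d^2 < e^2 := by nlinarith [hd.1]
  have hr2 : 0 < r^2 := by positivity
  nlinarith

open Filter Topology Set in
lemma trial (n : ℕ) (hn : 1 ≤ n) (r : ℝ) (hr : 0 < r) (hK1 : KK n r 1 = 0)
    (hne : ∀ y ∈ Ioo (0:ℝ) 1, KK n r y ≠ 0) (φ ψ χ P : ℝ → ℝ)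
    (hφ : ∀ y ∈ Ioo (0:ℝ) 1, HasDerivAt φ (ψ y / y) y)
    (hψ : ∀ y ∈ Ioo (0:ℝ) 1, HasDerivAt ψ (χ y / y) y)
    (hP : ∀ y ∈ Ioo (0:ℝ) 1,
      HasDerivAt P ((ψ y ^ 2 + n^2 * φ y ^ 2) / y - 4 * r^2 * y * φ y ^ 2) y)
    (hφc : Continuous φ) (hφ0 : φ 0 = 0) (hφ1 : φ 1 = 0) (hφd : DifferentiableAt ℝ φ 1)
    (hPc : Continuous P) (hP0 : P 0 = 0) (hP1 : P 1 ≤ 0) (c : ℝ) (hc : c ∈ Ioo (0:ℝ) 1)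
    (hχ : χ c ≠ (n^2 - 4*r^2*c^2) * φ c) : False := by
  set G : ℝ → ℝ := fun y => P y - φ y ^ 2 * (HH n r y / KK n r y) with hG
  have hGd : ∀ y ∈ Ioo (0:ℝ) 1,
      HasDerivAt G ((ψ y * KK n r y - φ y * HH n r y)^2 / (y * KK n r y ^ 2)) y := by
    intro y hy
    have hy0 : y ≠ 0 := hy.1.ne'
    have hk := hne y hy
    have := (hP y hy).sub (((hφ y hy).fun_pow 2).mul
      ((HH_hasDerivAt n r y hy0).div (KK_hasDerivAt n r y hy0) hk))
    refine this.congr_deriv ?_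
    rw [Pi.div_apply]
    push_cast
    field_simp
    ring
  have hmono : MonotoneOn G (Ioo 0 1) := by
    apply monotoneOn_of_deriv_nonneg (convex_Ioo 0 1)
    · exact fun y hy => (hGd y hy).continuousAt.continuousWithinAt
    · rw [interior_Ioo]
      exact fun y hy => (hGd y hy).differentiableAt.differentiableWithinAt
    · rw [interior_Ioo]
      intro y hy
      rw [(hGd y hy).deriv]
      have := hy.1
      positivity
  have hIoo0 : Ioo (0:ℝ) 1 ∈ 𝓝[>] (0:ℝ) := Ioo_mem_nhdsGT one_pos
  have hIoo1 : Ioo (0:ℝ) 1 ∈ 𝓝[<] (1:ℝ) := Ioo_mem_nhdsLT one_pos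
  have hlim0 : Tendsto G (𝓝[>] 0) (𝓝 0) := by
    have h1 : Tendsto (fun y => P y - φ y ^ 2 *
        (n - 2 * (r*y)^2 * FF (n+1) ((r*y)^2) / FF n ((r*y)^2))) (𝓝 0) (𝓝 0) := by
      have c1 := FF_cont n
      have c2 := FF_cont (n+1)
      have hz : FF n ((r*0)^2) ≠ 0 := by
        rw [mul_zero, zero_pow two_ne_zero, FF_zero]; positivity
      have : ContinuousAt (fun y => P y - φ y ^ 2 *
        (n - 2 * (r*y)^2 * FF (n+1) ((r*y)^2) / FF n ((r*y)^2))) 0 := by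
        refine hPc.continuousAt.sub ((hφc.pow 2).continuousAt.mul (continuousAt_const.sub ?_))
        refine ContinuousAt.div ?_ ?_ hz
        · exact Continuous.continuousAt (by fun_prop)
        · exact Continuous.continuousAt (by fun_prop)
      have h := this.tendsto
      simpa [hP0, hφ0] using h
    refine (h1.mono_left nhdsWithin_le_nhds).congr' ?_
    filter_upwards [hIoo0] with y hy
    have hk := hne y hy
    have : (r*y) ≠ 0 := (mul_pos hr hy.1).ne'
    simp only [hG]
    unfold HH KK
    unfold KK at hk
    have hF : FF n ((r*y)^2) ≠ 0 := right_ne_zero_of_mul hk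
    congr 2
    rw [pow_add]
    generalize FF n ((r*y)^2) = A at *
    generalize FF (n+1) ((r*y)^2) = B at *
    generalize r*y = z at *
    field_simp
  have hlim1 : Tendsto G (𝓝[<] 1) (𝓝 (P 1)) := by
    have s1 := (hasDerivAt_iff_tendsto_slope.1 hφd.hasDerivAt).mono_left
      (nhdsWithin_mono (1:ℝ) (fun y (hy : y < 1) => hy.ne))
    have s2 := (hasDerivAt_iff_tendsto_slope.1 (KK_hasDerivAt n r 1 one_ne_zero)).mono_left
      (nhdsWithin_mono (1:ℝ) (fun y (hy : y < 1) => hy.ne))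
    have hH1 := HH_one_ne n hn r hr hK1 hne
    have s3 : Tendsto (fun y : ℝ => (y-1) * HH n r y) (𝓝[<] 1) (𝓝 0) := by
      have : Continuous (fun y : ℝ => (y-1) * HH n r y) := by
        have := HH_cont n r
        fun_prop
      have h := this.tendsto 1
      simp only [sub_self, zero_mul] at h
      exact h.mono_left nhdsWithin_le_nhds
    have s4 : Tendsto P (𝓝[<] 1) (𝓝 (P 1)) := (hPc.tendsto 1).mono_left nhdsWithin_le_nhds
    have s5 := s4.sub (((s1.pow 2).mul s3).div s2 (by simpa using hH1))
    simp only [mul_zero, zero_div, sub_zero] at s5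
    refine s5.congr' ?_
    filter_upwards [hIoo1] with y hy
    have hk := hne y hy
    have hy1 : y - 1 ≠ 0 := (by linarith [hy.2] : y - 1 < 0).ne
    simp only [hG, slope_def_field, hφ1, hK1, sub_zero, Pi.div_apply]
    field_simp
  have hG0 : ∀ y ∈ Ioo (0:ℝ) 1, G y = 0 := by
    intro y hy
    apply le_antisymm
    · refine le_trans ?_ hP1
      refine ge_of_tendsto hlim1 ?_
      filter_upwards [Ioo_mem_nhdsLT hy.2] with z hz
      exact hmono hy ⟨hy.1.trans hz.1, hz.2⟩ hz.1.le
    · refine le_of_tendsto hlim0 ?_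
      filter_upwards [Ioo_mem_nhdsGT hy.1] with z hz
      exact hmono ⟨hz.1, hz.2.trans hy.2⟩ hy hz.2.le
  have hD0 : ∀ y ∈ Ioo (0:ℝ) 1, ψ y * KK n r y - φ y * HH n r y = 0 := by
    intro y hy
    have hev : G =ᶠ[𝓝 y] fun _ => 0 := by
      filter_upwards [isOpen_Ioo.mem_nhds hy] with z hz using hG0 z hz
    have h := (hGd y hy).unique ((hasDerivAt_const y (0:ℝ)).congr_of_eventuallyEq hev)
    have hk := hne y hy
    have hy0 := hy.1.ne'
    rcases div_eq_zero_iff.1 h with h | h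
    · exact pow_eq_zero_iff two_ne_zero |>.1 h
    · exact absurd h (mul_ne_zero hy0 (pow_ne_zero 2 hk))
  have hev : (fun y => ψ y * KK n r y - φ y * HH n r y) =ᶠ[𝓝 c] fun _ => 0 := by
    filter_upwards [isOpen_Ioo.mem_nhds hc] with z hz using hD0 z hz
  have hc0 := hc.1.ne'
  have hk := hne c hc
  have h := (((hψ c hc).mul (KK_hasDerivAt n r c hc0)).sub
    ((hφ c hc).mul (HH_hasDerivAt n r c hc0))).unique
    ((hasDerivAt_const c (0:ℝ)).congr_of_eventuallyEq hev)
  have h' : (χ c - (n^2 - 4*r^2*c^2) * φ c) * KK n r c = 0 := by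
    have := congrArg (fun z => z * c) h
    field_simp at this
    linarith
  rcases mul_eq_zero.1 h' with h | h
  · exact hχ (by linarith)
  · exact hk h

lemma case_two (r : ℝ) (hr : 0 < r) (hK1 : KK 2 r 1 = 0)
    (hne : ∀ y ∈ Set.Ioo (0:ℝ) 1, KK 2 r y ≠ 0) (hR : 27 ≤ 4 * r^2) : False := by
  refine trial 2 (by norm_num) r hr hK1 hne
    (fun y => 5*y^2 - 8*y^4 + 3*y^6) (fun y => 10*y^2 - 32*y^4 + 18*y^6)
    (fun y => 20*y^2 - 128*y^4 + 108*y^6)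
    (fun y => 50*y^4 - 160*y^6 + 220*y^8 - 672/5*y^10 + 30*y^12
      - 4*r^2*(25/6*y^6 - 10*y^8 + 47/5*y^10 - 4*y^12 + 9/14*y^14))
    ?_ ?_ ?_ (by fun_prop) (by norm_num) (by norm_num) (by fun_prop) (by fun_prop) (by norm_num)
    ?_ (1/2) (by norm_num) ?_
  · intro y hy
    have hy0 := hy.1.ne'
    have := (((hasDerivAt_pow 2 y).const_mul 5).sub ((hasDerivAt_pow 4 y).const_mul 8)).add
      ((hasDerivAt_pow 6 y).const_mul 3)
    refine this.congr_deriv ?_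
    field_simp; norm_num; ring
  · intro y hy
    have hy0 := hy.1.ne'
    have := (((hasDerivAt_pow 2 y).const_mul 10).sub ((hasDerivAt_pow 4 y).const_mul 32)).add
      ((hasDerivAt_pow 6 y).const_mul 18)
    refine this.congr_deriv ?_
    field_simp; norm_num; ring
  · intro y hy
    have hy0 := hy.1.ne'
    have := ((((((hasDerivAt_pow 4 y).const_mul 50).sub ((hasDerivAt_pow 6 y).const_mul 160)).add
      ((hasDerivAt_pow 8 y).const_mul 220)).sub ((hasDerivAt_pow 10 y).const_mul (672/5))).add
      ((hasDerivAt_pow 12 y).const_mul 30)).sub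
      ((((((hasDerivAt_pow 6 y).const_mul (25/6)).sub ((hasDerivAt_pow 8 y).const_mul 10)).add
      ((hasDerivAt_pow 10 y).const_mul (47/5))).sub ((hasDerivAt_pow 12 y).const_mul 4)).add
      ((hasDerivAt_pow 14 y).const_mul (9/14)) |>.const_mul (4*r^2))
    refine this.congr_deriv ?_
    field_simp; norm_num; ring
  · norm_num; linarith
  · intro h
    norm_num at h
    linarith

lemma case_ne_two (n : ℕ) (hn : 1 ≤ n) (hn2 : n ≠ 2) (r : ℝ) (hr : 0 < r) (hK1 : KK n r 1 = 0)
    (hne : ∀ y ∈ Set.Ioo (0:ℝ) 1, KK n r y ≠ 0) (a : ℝ) (ha : 0 < a) (ha2 : a^2 = n + 2)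
    (hR : (n+1) * (a+1)^2 ≤ 4 * r^2) : False := by
  have hn0 : (1:ℝ) ≤ n := by exact_mod_cast hn
  have hA : ∀ y : ℝ, 0 < y → HasDerivAt (fun y : ℝ => y^a) (a * y^a / y) y := by
    intro y hy
    refine (Real.hasDerivAt_rpow_const (Or.inl hy.ne')).congr_deriv ?_
    rw [Real.rpow_sub_one hy.ne']; ring
  have hN : ∀ y : ℝ, 0 < y → HasDerivAt (fun y : ℝ => y^n) (n * y^n / y) y := by
    intro y hy
    simpa using pow_hasDerivAt' n 1 y hy.ne'
  have hAc : Continuous (fun y : ℝ => y^a) := Real.continuous_rpow_const ha.le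
  have han : a^2 - n^2 ≠ 0 := by
    intro h
    have h1 : ((n:ℝ) - 2) * (n + 1) = 0 := by rw [ha2] at h; linarith
    rcases mul_eq_zero.1 h1 with h | h
    · exact hn2 (by exact_mod_cast (by linarith : (n:ℝ) = 2))
    · linarith
  obtain ⟨c, hc, hcE⟩ : ∃ c ∈ Set.Ioo (0:ℝ) 1,
      (a^2 * c^a - n^2*c^n) - (n^2 - 4*r^2*c^2) * (c^a - c^n) ≠ 0 := by
    have hcont : Continuous (fun c : ℝ =>
        (a^2 * c^a - n^2*c^n) - (n^2 - 4*r^2*c^2) * (c^a - c^n)) := by fun_prop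
    have h := hcont.continuousAt.eventually_ne (x := 1) (y := 0) (by simpa using han)
    have h2 := (h.filter_mono (nhdsWithin_le_nhds (s := Set.Iio 1))).and
      (Ioo_mem_nhdsLT (zero_lt_one' ℝ))
    obtain ⟨c, h3, h4⟩ := h2.exists
    exact ⟨c, h4, h3⟩
  refine trial n hn r hr hK1 hne
    (fun y => y^a - y^n) (fun y => a*y^a - n*y^n) (fun y => a^2*y^a - n^2*y^n)
    (fun y => (a^2+n^2)/(2*a) * (y^a)^2 - 2*n*(y^a*y^n) + n*(y^n)^2
      - 4*r^2*(y^2 * (1/(2*a+2)*(y^a)^2 - 2/(a+n+2)*(y^a*y^n) + 1/(2*n+2)*(y^n)^2)))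
    ?_ ?_ ?_ (by fun_prop) ?_ (by simp) ?_ (by fun_prop) ?_
    ?_ c hc (fun h => hcE (by linarith))
  · intro y hy
    refine ((hA y hy.1).sub (hN y hy.1)).congr_deriv ?_
    ring
  · intro y hy
    refine (((hA y hy.1).const_mul a).sub ((hN y hy.1).const_mul (n:ℝ))).congr_deriv ?_
    ring
  · intro y hy
    have hy0 := hy.1.ne'
    have d1 := (hA y hy.1).fun_pow 2
    have d2 := (hA y hy.1).fun_mul (hN y hy.1)
    have d3 := (hN y hy.1).fun_pow 2
    have := (((d1.const_mul ((a^2+n^2)/(2*a))).sub (d2.const_mul (2*(n:ℝ)))).add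
      (d3.const_mul (n:ℝ))).sub
      (((hasDerivAt_pow 2 y).mul (((d1.const_mul (1/(2*a+2))).sub (d2.const_mul (2/(a+n+2)))).add
      (d3.const_mul (1/(2*(n:ℝ)+2))))).const_mul (4*r^2))
    refine this.congr_deriv ?_
    simp only [Pi.sub_apply, Pi.add_apply, Nat.cast_ofNat, Nat.add_one_sub_one, pow_one]
    generalize y^a = A
    generalize y^n = N
    have e1 : a + n + 2 ≠ 0 := by positivity
    have e2 : (n:ℝ) + 1 ≠ 0 := by positivity
    have e3 : a + 1 ≠ 0 := by positivity
    rw [show 2*a+2 = 2*(a+1) by ring, show 2*(n:ℝ)+2 = 2*(n+1) by ring]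
    field_simp
    ring
  · simp [Real.zero_rpow ha.ne', show n ≠ 0 by omega]
  · exact ((hA 1 one_pos).sub (hN 1 one_pos)).differentiableAt
  · simp [Real.zero_rpow ha.ne', show n ≠ 0 by omega]
  · simp only [Real.one_rpow, one_pow, mul_one, one_mul]
    have e1 : 0 < a + n + 2 := by positivity
    have e2 : 0 < (n:ℝ) + 1 := by positivity
    have e3 : 0 < a + 1 := by positivity
    have e : 1/(2*a+2) - 2/(a+n+2) + 1/(2*(n:ℝ)+2) = (a-n)^2/(2*(n+1)*(a+1)*(a+n+2)) := by
      rw [show 2*a+2 = 2*(a+1) by ring, show 2*(n:ℝ)+2 = 2*(n+1) by ring]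
      field_simp
      ring
    have e' : (a^2+n^2)/(2*a) - 2*n + n = (n+1)*(a+1)^2 * ((a-n)^2/(2*(n+1)*(a+1)*(a+n+2))) := by
      rw [show a + n + 2 = a*(a+1) by linarith]
      field_simp
      ring
    rw [e, e', ← sub_mul]
    exact mul_nonpos_of_nonpos_of_nonneg (by linarith) (by positivity)

theorem first_zeros_bounds (n : ℕ) (hn : 1 ≤ n) (j1 j1' : ℝ)
    (hj1_pos : 0 < j1) (hj1_zero : besselJ n j1 = 0)
    (hj1_min : ∀ x : ℝ, 0 < x → besselJ n x = 0 → j1 ≤ x)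
    (hj1'_pos : 0 < j1') (hj1'_zero : deriv (besselJ n) j1' = 0)
    (hj1'_min : ∀ x : ℝ, 0 < x → deriv (besselJ n) x = 0 → j1' ≤ x) :
    (n : ℝ) < j1' ∧ j1' < j1 ∧
      j1 < Real.sqrt ((n : ℝ) + 1) * (Real.sqrt ((n : ℝ) + 2) + 1) := by
  have hJK : ∀ x, besselJ n x = KK n (1/2) x := by
    intro x
    rw [besselJ_eq_s12]; unfold KK
    rw [show x/2 = 1/2*x by ring]
  have hJK' : besselJ n = KK n (1/2) := funext hJK
  have hJd : ∀ x, 0 < x → deriv (besselJ n) x = HH n (1/2) x / x := by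
    intro x hx
    rw [hJK']
    exact (KK_hasDerivAt n (1/2) x hx.ne').deriv
  have h2 : j1' < j1 := by
    obtain ⟨c, hc, h⟩ := KK_rolle n (1/2) 0 j1 le_rfl hj1_pos (KK_zero n hn _)
      (by rw [← hJK, hj1_zero])
    refine lt_of_le_of_lt (hj1'_min c hc.1 ?_) hc.2
    rw [hJd c hc.1, h, zero_div]
  refine ⟨?_, h2, ?_⟩
  · by_contra hcon
    push Not at hcon
    have hH : HH n (1/2) j1' = 0 := by
      rw [hJd j1' hj1'_pos] at hj1'_zero
      exact (div_eq_zero_iff.1 hj1'_zero).resolve_right hj1'_pos.ne'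
    obtain ⟨c, hc, h⟩ := HH_rolle n (1/2) 0 j1' le_rfl hj1'_pos (HH_zero n hn _) hH
    rcases h with h | h
    · have : c < n := hc.2.trans_le hcon
      nlinarith [hc.1]
    · have := hj1_min c hc.1 (by rw [hJK, h])
      linarith [hc.2]
  · by_contra hcon
    push Not at hcon
    have hscale : ∀ y, KK n (j1/2) y = besselJ n (j1*y) := by
      intro y
      rw [besselJ_eq_s12]; unfold KK
      rw [show j1*y/2 = j1/2*y by ring]
    have hK1 : KK n (j1/2) 1 = 0 := by rw [hscale, mul_one, hj1_zero]
    have hne : ∀ y ∈ Set.Ioo (0:ℝ) 1, KK n (j1/2) y ≠ 0 := by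
      intro y hy h
      rw [hscale] at h
      have := hj1_min _ (mul_pos hj1_pos hy.1) h
      nlinarith [hy.2]
    have ha : 0 < Real.sqrt ((n:ℝ)+2) := Real.sqrt_pos.2 (by positivity)
    have ha2 : Real.sqrt ((n:ℝ)+2)^2 = n + 2 := Real.sq_sqrt (by positivity)
    have hR : ((n:ℝ)+1) * (Real.sqrt ((n:ℝ)+2)+1)^2 ≤ 4 * (j1/2)^2 := by
      have h := pow_le_pow_left₀ (by positivity) hcon 2
      rw [mul_pow, Real.sq_sqrt (by positivity)] at h
      linarith
    by_cases hn2 : n = 2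
    · subst hn2
      refine case_two (j1/2) (by positivity) hK1 hne ?_
      have : Real.sqrt (((2:ℕ):ℝ)+2) = 2 := by
        rw [show (((2:ℕ):ℝ)+2) = 2^2 by norm_num]
        exact Real.sqrt_sq (by norm_num)
      rw [this] at hR
      norm_num at hR ⊢
      linarith
    · exact case_ne_two n hn hn2 (j1/2) (by positivity) hK1 hne _ ha ha2 hR
end

section
/- (Kapteyn's inequality) For every real ν > 0 and every x ∈ (0,1), one has 0 < J_ν(νx) < x^ν · exp(ν√(1−x²)) / (1 + √(1−x²))^ν. -/
open Real

/-- coefficients of the reduced Bessel function -/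
noncomputable def kapA (ν : ℝ) (k : ℕ) : ℝ := (-1 : ℝ) ^ k / ((k.factorial : ℝ) * Real.Gamma ((k : ℝ) + ν + 1))

noncomputable def kapE (ν z : ℝ) : ℝ := ∑' k : ℕ, kapA ν k * z ^ k

lemma kap_Gamma_pos (ν : ℝ) (hν : 0 ≤ ν) (k : ℕ) : 0 < Real.Gamma ((k : ℝ) + ν + 1) :=
  Real.Gamma_pos_of_pos (by positivity)

lemma kap_Gamma_ge (ν : ℝ) (hν : 0 ≤ ν) (k : ℕ) :
    Real.Gamma (ν + 1) ≤ Real.Gamma ((k : ℝ) + ν + 1) := by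
  induction k with
  | zero => simp
  | succ k ih =>
    have h : ((k + 1 : ℕ) : ℝ) + ν + 1 = ((k : ℝ) + ν + 1) + 1 := by push_cast; ring
    have hk : (0 : ℝ) ≤ k := by positivity
    have hk' : (0 : ℝ) < (k : ℝ) + ν + 1 := by positivity
    rw [h, Real.Gamma_add_one hk'.ne']
    have := kap_Gamma_pos ν hν k
    nlinarith

lemma kapA_abs (ν : ℝ) (hν : 0 ≤ ν) (k : ℕ) :
    |kapA ν k| ≤ (Real.Gamma (ν + 1))⁻¹ * ((k.factorial : ℝ))⁻¹ := by
  have h0 : 0 < Real.Gamma (ν + 1) := Real.Gamma_pos_of_pos (by positivity)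
  have h1 := kap_Gamma_pos ν hν k
  have h2 := kap_Gamma_ge ν hν k
  have h3 : (0 : ℝ) < k.factorial := by positivity
  unfold kapA
  rw [abs_div, abs_pow, abs_neg, abs_one, one_pow, abs_of_pos (by positivity), one_div, mul_inv,
    mul_comm]
  gcongr

lemma kapE_summable (ν z : ℝ) (hν : 0 ≤ ν) : Summable fun k : ℕ => kapA ν k * z ^ k := by
  have h := (Real.summable_pow_div_factorial |z|).mul_left (Real.Gamma (ν + 1))⁻¹
  refine Summable.of_norm_bounded h fun k => ?_
  rw [Real.norm_eq_abs, abs_mul, abs_pow]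
  calc _ ≤ ((Real.Gamma (ν + 1))⁻¹ * ((k.factorial : ℝ))⁻¹) * |z| ^ k := by
        gcongr; exact kapA_abs ν hν k
    _ = _ := by ring

lemma kapA_succ (ν : ℝ) (hν : 0 ≤ ν) (k : ℕ) :
    kapA ν (k + 1) * ((k : ℝ) + 1) = - kapA (ν + 1) k := by
  have h1 := kap_Gamma_pos (ν + 1) (by positivity) k
  have h3 : (0 : ℝ) < k.factorial := by positivity
  unfold kapA
  have h : ((k + 1 : ℕ) : ℝ) + ν + 1 = (k : ℝ) + (ν + 1) + 1 := by push_cast; ring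
  rw [h, Nat.factorial_succ, pow_succ]
  push_cast
  field_simp

lemma kapE_hasDerivAt (ν z : ℝ) (hν : 0 ≤ ν) : HasDerivAt (kapE ν) (-kapE (ν + 1) z) z := by
  set R := |z| + 1 with hR
  have hRpos : 0 < R := by positivity
  set u : ℕ → ℝ := fun k => (Real.Gamma (ν + 1))⁻¹ * (R ^ (k - 1) * k / k.factorial) with hu
  have hΓ : 0 < Real.Gamma (ν + 1) := Real.Gamma_pos_of_pos (by positivity)
  have hus : Summable u := by
    refine Summable.mul_left _ ?_
    rw [← summable_nat_add_iff 1]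
    refine (Real.summable_pow_div_factorial R).congr fun k => ?_
    rw [Nat.factorial_succ]
    push_cast
    have h3 : (0 : ℝ) < k.factorial := by positivity
    have h4 : (0 : ℝ) < (k : ℝ) + 1 := by positivity
    field_simp
  have key := hasDerivAt_tsum_of_isPreconnected (𝕜 := ℝ) (g := fun k y => kapA ν k * y ^ k)
    (g' := fun k y => kapA ν k * (k * y ^ (k - 1))) (t := Metric.ball (0 : ℝ) R) (y₀ := 0) (y := z)
    hus Metric.isOpen_ball (convex_ball _ _).isPreconnected
    (fun k y _ => (hasDerivAt_pow k y).const_mul _)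
    (fun k y hy => by
      have hy' : |y| ≤ R := by
        have := Metric.mem_ball.1 hy
        rw [dist_zero_right, Real.norm_eq_abs] at this
        exact this.le
      rw [Real.norm_eq_abs, abs_mul, abs_mul, abs_pow, Nat.abs_cast]
      calc _ ≤ ((Real.Gamma (ν + 1))⁻¹ * ((k.factorial : ℝ))⁻¹) * (k * R ^ (k - 1)) := by
            gcongr; exact kapA_abs ν hν k
        _ = u k := by simp only [hu]; ring)
    (Metric.mem_ball_self hRpos) (kapE_summable ν 0 hν)
    (by rw [Metric.mem_ball, dist_zero_right, Real.norm_eq_abs]; linarith)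
  have e : ∑' k : ℕ, kapA ν k * (k * z ^ (k - 1)) = - kapE (ν + 1) z := by
    have hs : Summable fun k : ℕ => kapA ν k * (k * z ^ (k - 1)) := by
      rw [← summable_nat_add_iff 1]
      refine (kapE_summable (ν + 1) z (by positivity)).neg.congr fun k => ?_
      have := kapA_succ ν hν k
      rw [Nat.add_sub_cancel]
      push_cast
      rw [← mul_assoc, this]; ring
    rw [hs.tsum_eq_zero_add]
    unfold kapE
    rw [← tsum_neg]
    simp only [Nat.cast_zero, zero_mul, mul_zero, zero_add]
    congr 1
    ext k
    have := kapA_succ ν hν k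
    rw [Nat.add_sub_cancel]
    push_cast
    rw [← mul_assoc, this]; ring
  rw [← e]
  exact key

lemma kapE_rec (ν z : ℝ) (hν : 0 ≤ ν) :
    kapE ν z = (ν + 1) * kapE (ν + 1) z - z * kapE (ν + 2) z := by
  have s1 := kapE_summable (ν + 1) z (by positivity)
  have s2 := kapE_summable (ν + 2) z (by positivity)
  have s0 := kapE_summable ν z hν
  have e1 : ∀ k, kapA ν k = (k + ν + 1) * kapA (ν + 1) k := by
    intro k
    have h1 := kap_Gamma_pos ν hν k
    have h3 : (0 : ℝ) < k.factorial := by positivity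
    unfold kapA
    have h : (k : ℝ) + (ν + 1) + 1 = (k + ν + 1) + 1 := by ring
    have h4 : (0 : ℝ) < k + ν + 1 := by positivity
    rw [h, Real.Gamma_add_one h4.ne']
    field_simp
  have e2 : ∀ k : ℕ, kapA (ν + 1) (k + 1) * ((k : ℝ) + 1) = - kapA (ν + 2) k := by
    intro k
    rw [kapA_succ _ (by positivity)]
    congr 2; ring
  unfold kapE
  rw [s0.tsum_eq_zero_add, s1.tsum_eq_zero_add, mul_add, ← tsum_mul_left, ← tsum_mul_left,
    add_sub_assoc, ← Summable.tsum_sub (((summable_nat_add_iff 1).2 s1).mul_left _) (s2.mul_left z)]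
  congr 1
  · rw [e1]; simp
  · congr 1
    ext k
    rw [e1]
    have := e2 k
    push_cast
    linear_combination z ^ (k + 1) * this

lemma kapE_zero (ν : ℝ) : kapE ν 0 = (Real.Gamma (ν + 1))⁻¹ := by
  unfold kapE
  rw [tsum_eq_single 0]
  · simp [kapA]
  · intro k hk; simp [hk]

lemma besselJ_eq_s14 (ν t : ℝ) (ht : 0 < t) : besselJ ν t = (t / 2) ^ ν * kapE ν (t ^ 2 / 4) := by
  unfold besselJ kapE
  rw [← tsum_mul_left]
  congr 1
  ext k
  rw [Real.rpow_add (by positivity), Real.rpow_mul (by positivity), Real.rpow_natCast]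
  have : (t / 2) ^ (2 : ℝ) = t ^ 2 / 4 := by
    rw [show (2 : ℝ) = ((2 : ℕ) : ℝ) by norm_num, Real.rpow_natCast]; push_cast; ring
  rw [this]
  unfold kapA
  ring

lemma kap_ode (p d α β : ℝ → ℝ) (hp : ContinuousOn p (Set.Icc 0 1))
    (hd : ContinuousOn d (Set.Icc 0 1)) (hp0 : 0 < p 0) (hd0 : d 0 = 0)
    (hα : ∀ x ∈ Set.Ioo (0 : ℝ) 1, 0 < α x) (hβ : ∀ x ∈ Set.Ioo (0 : ℝ) 1, 0 < β x)
    (hp' : ∀ x ∈ Set.Ioo (0 : ℝ) 1, HasDerivAt p (α x * d x) x)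
    (hd' : ∀ x ∈ Set.Ioo (0 : ℝ) 1, HasDerivAt d (β x * p x) x) :
    (∀ x ∈ Set.Icc (0 : ℝ) 1, 0 < p x) ∧ (∀ x ∈ Set.Icc (0 : ℝ) 1, 0 ≤ d x) ∧
      StrictMonoOn p (Set.Icc 0 1) := by
  have hpos : ∀ x ∈ Set.Icc (0 : ℝ) 1, 0 < p x := by
    by_contra! hcon
    obtain ⟨x0, hx0, hpx0⟩ := hcon
    set S := Set.Icc (0 : ℝ) 1 ∩ p ⁻¹' Set.Iic 0 with hS
    have hSc : IsCompact S := (isCompact_Icc).of_isClosed_subset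
      (hp.preimage_isClosed_of_isClosed isClosed_Icc isClosed_Iic) Set.inter_subset_left
    have hSn : S.Nonempty := ⟨x0, hx0, hpx0⟩
    have hc := hSc.sInf_mem hSn
    set c := sInf S with hcdef
    have hc1 : c ∈ Set.Icc (0 : ℝ) 1 := hc.1
    have hc2 : p c ≤ 0 := hc.2
    have hlt : ∀ x ∈ Set.Ioo 0 c, 0 < p x := by
      intro x hx
      by_contra! h
      have : c ≤ x := csInf_le hSc.bddBelow ⟨⟨hx.1.le, hx.2.le.trans hc1.2⟩, h⟩
      exact absurd hx.2 (not_lt.2 this)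
    have hsub : Set.Icc 0 c ⊆ Set.Icc (0 : ℝ) 1 := Set.Icc_subset_Icc_right hc1.2
    have hsub' : Set.Ioo 0 c ⊆ Set.Ioo (0 : ℝ) 1 := Set.Ioo_subset_Ioo_right hc1.2
    have hdm : MonotoneOn d (Set.Icc 0 c) := by
      refine monotoneOn_of_deriv_nonneg (convex_Icc _ _) (hd.mono hsub) ?_ ?_
      · rw [interior_Icc]
        exact fun x hx => (hd' x (hsub' hx)).differentiableAt.differentiableWithinAt
      · rw [interior_Icc]
        intro x hx
        rw [(hd' x (hsub' hx)).deriv]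
        exact (mul_pos (hβ x (hsub' hx)) (hlt x hx)).le
    have hpm : MonotoneOn p (Set.Icc 0 c) := by
      refine monotoneOn_of_deriv_nonneg (convex_Icc _ _) (hp.mono hsub) ?_ ?_
      · rw [interior_Icc]
        exact fun x hx => (hp' x (hsub' hx)).differentiableAt.differentiableWithinAt
      · rw [interior_Icc]
        intro x hx
        rw [(hp' x (hsub' hx)).deriv]
        have := hdm (Set.left_mem_Icc.2 hc1.1) (Set.Ioo_subset_Icc_self hx) hx.1.le
        rw [hd0] at this
        exact mul_nonneg (hα x (hsub' hx)).le this
    have := hpm (Set.left_mem_Icc.2 hc1.1) (Set.right_mem_Icc.2 hc1.1) hc1.1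
    linarith
  have hdm : StrictMonoOn d (Set.Icc 0 1) := by
    refine strictMonoOn_of_deriv_pos (convex_Icc _ _) hd ?_
    rw [interior_Icc]
    intro x hx
    rw [(hd' x hx).deriv]
    exact mul_pos (hβ x hx) (hpos x (Set.Ioo_subset_Icc_self hx))
  refine ⟨hpos, fun x hx => ?_, ?_⟩
  · have := hdm.monotoneOn (Set.left_mem_Icc.2 zero_le_one) hx hx.1
    rwa [hd0] at this
  · refine strictMonoOn_of_deriv_pos (convex_Icc _ _) hp ?_
    rw [interior_Icc]
    intro x hx
    rw [(hp' x hx).deriv]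
    have := hdm (Set.left_mem_Icc.2 zero_le_one) (Set.Ioo_subset_Icc_self hx) hx.1
    rw [hd0] at this
    exact mul_pos (hα x hx) this

noncomputable def kapS (x : ℝ) : ℝ := Real.sqrt (1 - x ^ 2)
noncomputable def kapH (ν x : ℝ) : ℝ := Real.exp (ν * (Real.log (1 + kapS x) - kapS x))
noncomputable def kapM (ν x : ℝ) : ℝ :=
  (1 - kapS x) * kapE ν (ν ^ 2 * x ^ 2 / 4) - ν * x ^ 2 / 2 * kapE (ν + 1) (ν ^ 2 * x ^ 2 / 4)

lemma kapS_nonneg (x : ℝ) : 0 ≤ kapS x := Real.sqrt_nonneg _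
lemma kapS_cont : Continuous kapS := by unfold kapS; fun_prop
lemma kapH_cont (ν : ℝ) : Continuous (kapH ν) := by
  unfold kapH
  have h := kapS_cont
  have : Continuous fun x => Real.log (1 + kapS x) :=
    Continuous.log (by fun_prop) (fun x => by have := kapS_nonneg x; positivity)
  fun_prop
lemma kapE_cont (ν : ℝ) (hν : 0 ≤ ν) : Continuous (kapE ν) :=
  continuous_iff_continuousAt.2 fun z => (kapE_hasDerivAt ν z hν).continuousAt

lemma kapS_deriv (x : ℝ) (hx : x ∈ Set.Ioo (0 : ℝ) 1) : HasDerivAt kapS (-x / kapS x) x := by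
  have h1 : 0 < 1 - x ^ 2 := by nlinarith [hx.1, hx.2]
  have := (((hasDerivAt_pow 2 x).const_sub 1).sqrt h1.ne')
  have h2 : 0 < √(1 - x ^ 2) := Real.sqrt_pos.2 h1
  refine HasDerivAt.congr_deriv (f := kapS) this ?_
  unfold kapS
  field_simp
  norm_num

lemma kapH_deriv (ν x : ℝ) (hx : x ∈ Set.Ioo (0 : ℝ) 1) :
    HasDerivAt (kapH ν) (kapH ν x * (ν * x / (1 + kapS x))) x := by
  have h1 : 0 < 1 - x ^ 2 := by nlinarith [hx.1, hx.2]
  have hs : 0 < kapS x := Real.sqrt_pos.2 h1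
  have hS := kapS_deriv x hx
  have := (((hS.const_add 1).log (by positivity)).sub hS |>.const_mul ν).exp
  refine HasDerivAt.congr_deriv (f := kapH ν) this ?_
  simp only [kapH, Pi.sub_apply]
  congr 1
  field_simp
  ring

lemma kapEc_deriv (ν c x : ℝ) (hν : 0 ≤ ν) :
    HasDerivAt (fun x => kapE ν (c ^ 2 * x ^ 2 / 4))
      (-kapE (ν + 1) (c ^ 2 * x ^ 2 / 4) * (c ^ 2 * x / 2)) x := by
  have h2 : HasDerivAt (fun x : ℝ => c ^ 2 * x ^ 2 / 4) (c ^ 2 * x / 2) x := by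
    have := ((hasDerivAt_pow 2 x).const_mul (c ^ 2)).div_const 4
    refine this.congr_deriv ?_
    push_cast; ring
  exact (kapE_hasDerivAt ν _ hν).comp x h2

lemma kapM_deriv (ν x : ℝ) (hν : 0 < ν) (hx : x ∈ Set.Ioo (0 : ℝ) 1) :
    HasDerivAt (kapM ν) (x * (1 / kapS x - ν) * kapE ν (ν ^ 2 * x ^ 2 / 4)
      + ν ^ 2 * x / 2 * (1 + kapS x) * kapE (ν + 1) (ν ^ 2 * x ^ 2 / 4)) x := by
  have h1 : 0 < 1 - x ^ 2 := by nlinarith [hx.1, hx.2]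
  have hs : 0 < kapS x := Real.sqrt_pos.2 h1
  have hS := kapS_deriv x hx
  have hE0 := kapEc_deriv ν ν x hν.le
  have hE1 := kapEc_deriv (ν + 1) ν x (by positivity)
  have hq : HasDerivAt (fun x : ℝ => ν * x ^ 2 / 2) (ν * x) x := by
    have := ((hasDerivAt_pow 2 x).const_mul ν).div_const 2
    refine this.congr_deriv ?_
    push_cast; ring
  have := ((hS.const_sub 1).mul hE0).sub (hq.mul hE1)
  unfold kapM
  have hrec := kapE_rec ν (ν ^ 2 * x ^ 2 / 4) hν.le
  rw [show ν + 1 + 1 = ν + 2 by ring] at this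
  refine this.congr_deriv ?_
  generalize kapE ν (ν ^ 2 * x ^ 2 / 4) = E0 at *
  generalize kapE (ν + 1) (ν ^ 2 * x ^ 2 / 4) = E1 at *
  generalize kapE (ν + 2) (ν ^ 2 * x ^ 2 / 4) = E2 at *
  have e : -(-x / kapS x) = x * (1 / kapS x) := by ring
  rw [e]
  linear_combination (ν * x) * hrec

lemma kap_main (ν : ℝ) (hν : 0 < ν) :
    (∀ x ∈ Set.Icc (0 : ℝ) 1, 0 < kapE ν (ν ^ 2 * x ^ 2 / 4)) ∧
    (∀ x ∈ Set.Ioc (0 : ℝ) 1, 0 ≤ kapM ν x) ∧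
      StrictMonoOn (fun x => kapE ν (ν ^ 2 * x ^ 2 / 4) * kapH ν x) (Set.Icc 0 1) := by
  have hHpos : ∀ x, 0 < kapH ν x := fun x => Real.exp_pos _
  have hHc := kapH_cont ν
  have hSc := kapS_cont
  have hEc0 : Continuous fun x : ℝ => kapE ν (ν ^ 2 * x ^ 2 / 4) :=
    (kapE_cont ν hν.le).comp (by fun_prop)
  have hEc1 : Continuous fun x : ℝ => kapE (ν + 1) (ν ^ 2 * x ^ 2 / 4) :=
    (kapE_cont (ν + 1) (by positivity)).comp (by fun_prop)
  have hMc : Continuous (kapM ν) := by unfold kapM; fun_prop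
  have hXc : Continuous fun x : ℝ => x ^ (2 * ν) :=
    Continuous.rpow_const continuous_id (fun x => Or.inr (by positivity))
  have hdc : Continuous fun x : ℝ => x ^ (2 * ν) * kapM ν x / kapH ν x :=
    (hXc.mul hMc).div hHc (fun x => (hHpos x).ne')
  obtain ⟨h1, h2, h3⟩ := kap_ode (fun x => kapE ν (ν ^ 2 * x ^ 2 / 4) * kapH ν x)
    (fun x => x ^ (2 * ν) * kapM ν x / kapH ν x)
    (fun x => ν * kapH ν x ^ 2 / (x ^ (2 * ν) * x))
    (fun x => x ^ (2 * ν) * x / (kapS x * kapH ν x ^ 2))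
    (hEc0.mul hHc).continuousOn hdc.continuousOn
    (by
      have : 0 < Real.Gamma (ν + 1) := Real.Gamma_pos_of_pos (by positivity)
      have := hHpos 0
      simp only [ne_eq, OfNat.ofNat_ne_zero, not_false_eq_true, zero_pow, mul_zero, zero_div,
        kapE_zero]
      positivity)
    (by
      have : (0 : ℝ) ^ (2 * ν) = 0 := Real.zero_rpow (by positivity)
      simp only [this, zero_mul, zero_div])
    (by
      intro x hx
      have := hHpos x
      have := Real.rpow_pos_of_pos hx.1 (2 * ν)
      have := hx.1
      positivity)
    (by
      intro x hx
      have h1 : 0 < 1 - x ^ 2 := by nlinarith [hx.1, hx.2]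
      have hs : 0 < kapS x := Real.sqrt_pos.2 h1
      have := hHpos x
      have := Real.rpow_pos_of_pos hx.1 (2 * ν)
      have := hx.1
      positivity)
    (by
      intro x hx
      have h1 : 0 < 1 - x ^ 2 := by nlinarith [hx.1, hx.2]
      have hs : 0 < kapS x := Real.sqrt_pos.2 h1
      have hs2 : kapS x ^ 2 = 1 - x ^ 2 := Real.sq_sqrt h1.le
      have hH := hHpos x
      have hX := Real.rpow_pos_of_pos hx.1 (2 * ν)
      have hx0 := hx.1
      have := (kapEc_deriv ν ν x hν.le).mul (kapH_deriv ν x hx)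
      refine this.congr_deriv ?_
      simp only [kapM]
      generalize kapE ν (ν ^ 2 * x ^ 2 / 4) = E0 at *
      generalize kapE (ν + 1) (ν ^ 2 * x ^ 2 / 4) = E1 at *
      generalize kapH ν x = H at *
      generalize x ^ (2 * ν) = X at *
      generalize kapS x = s at *
      field_simp
      linear_combination (2 * E0) * hs2)
    (by
      intro x hx
      have h1 : 0 < 1 - x ^ 2 := by nlinarith [hx.1, hx.2]
      have hs : 0 < kapS x := Real.sqrt_pos.2 h1
      have hs2 : kapS x ^ 2 = 1 - x ^ 2 := Real.sq_sqrt h1.le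
      have hH := hHpos x
      have hX := Real.rpow_pos_of_pos hx.1 (2 * ν)
      have hx0 := hx.1
      have hXd : HasDerivAt (fun x : ℝ => x ^ (2 * ν)) (2 * ν * (x ^ (2 * ν) / x)) x := by
        have := Real.hasDerivAt_rpow_const (x := x) (p := 2 * ν) (Or.inl hx0.ne')
        rwa [Real.rpow_sub_one hx0.ne'] at this
      have := (hXd.mul (kapM_deriv ν x hν hx)).div (kapH_deriv ν x hx) hH.ne'
      refine this.congr_deriv ?_
      simp only [kapM, Pi.mul_apply]
      generalize kapE ν (ν ^ 2 * x ^ 2 / 4) = E0 at *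
      generalize kapE (ν + 1) (ν ^ 2 * x ^ 2 / 4) = E1 at *
      generalize kapH ν x = H at *
      generalize x ^ (2 * ν) = X at *
      generalize kapS x = s at *
      have hx2 : x ^ 2 = 1 - s ^ 2 := by linarith
      field_simp
      simp only [hx2]
      ring)
  refine ⟨fun x hx => ?_, fun x hx => ?_, h3⟩
  · exact pos_of_mul_pos_left (h1 x hx) (hHpos x).le
  · have h := h2 x ⟨hx.1.le, hx.2⟩
    have hX := Real.rpow_pos_of_pos hx.1 (2 * ν)
    have hH := hHpos x
    by_contra! hneg
    have : x ^ (2 * ν) * kapM ν x / kapH ν x < 0 :=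
      div_neg_of_neg_of_pos (mul_neg_of_pos_of_neg hX hneg) hH
    linarith

/-- positivity of `E_ν` up to `(ν+1)²/4`. -/
lemma kapE_pos (ν t : ℝ) (hν : 0 ≤ ν) (ht : 0 < t) (ht1 : t ≤ ν + 1) :
    0 < kapE ν (t ^ 2 / 4) := by
  have hm := kap_main (ν + 1) (by positivity)
  have hn : 0 < ν + 1 := by positivity
  set x := t / (ν + 1) with hx
  have hx0 : 0 < x := by positivity
  have hx1 : x ≤ 1 := (div_le_one hn).2 ht1
  have hE := hm.1 x ⟨hx0.le, hx1⟩
  have hM := hm.2.1 x ⟨hx0, hx1⟩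
  have ez : (ν + 1) ^ 2 * x ^ 2 / 4 = t ^ 2 / 4 := by rw [hx]; field_simp
  have hrec := kapE_rec ν (t ^ 2 / 4) hν
  have hs := kapS_nonneg x
  unfold kapM at hM
  rw [ez] at hE hM
  rw [show ν + 1 + 1 = ν + 2 by ring] at hM
  have ez' : t ^ 2 / 4 * kapE (ν + 2) (t ^ 2 / 4)
      = (ν + 1) / 2 * ((ν + 1) * x ^ 2 / 2 * kapE (ν + 2) (t ^ 2 / 4)) := by
    rw [← ez]; ring
  rw [hrec, ez']
  nlinarith [mul_nonneg hn.le hM, mul_pos hn hE, mul_nonneg hn.le (mul_nonneg hs hE.le)]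

lemma kap_Q1 (ν : ℝ) (hν : 0 < ν) :
    ν / 2 * kapE (ν + 1) (ν ^ 2 / 4) ≤ kapE ν (ν ^ 2 / 4) := by
  have := (kap_main ν hν).2.1 1 ⟨one_pos, le_rfl⟩
  unfold kapM kapS at this
  simp at this
  linarith

noncomputable def kapJ (ν t : ℝ) : ℝ := (t / 2) ^ ν * kapE ν (t ^ 2 / 4)
noncomputable def kapQ (ν t : ℝ) : ℝ :=
  (t / 2) ^ ν * (ν * kapE ν (t ^ 2 / 4) - t ^ 2 / 2 * kapE (ν + 1) (t ^ 2 / 4))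

lemma kapE4_deriv (ν t : ℝ) (hν : 0 ≤ ν) : HasDerivAt (fun t => kapE ν (t ^ 2 / 4))
    (-kapE (ν + 1) (t ^ 2 / 4) * (t / 2)) t := by
  simpa using kapEc_deriv ν 1 t hν

lemma kapX_deriv (ν t : ℝ) (ht : 0 < t) : HasDerivAt (fun t : ℝ => (t / 2) ^ ν)
    (ν * (t / 2) ^ ν / t) t := by
  have h := ((hasDerivAt_id t).div_const 2).rpow_const (p := ν) (Or.inl (by simp; positivity))
  refine h.congr_deriv ?_
  simp only [id]
  rw [Real.rpow_sub_one (by positivity)]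
  field_simp

lemma kapJ_deriv (ν t : ℝ) (hν : 0 ≤ ν) (ht : 0 < t) : HasDerivAt (kapJ ν) (kapQ ν t / t) t := by
  have := (kapX_deriv ν t ht).mul (kapE4_deriv ν t hν)
  refine HasDerivAt.congr_deriv (f := kapJ ν) this ?_
  unfold kapQ
  field_simp
  ring

lemma kapQ_deriv (ν t : ℝ) (hν : 0 ≤ ν) (ht : 0 < t) :
    HasDerivAt (kapQ ν) ((ν ^ 2 - t ^ 2) / t * kapJ ν t) t := by
  have hq : HasDerivAt (fun t : ℝ => t ^ 2 / 2) t t := by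
    refine ((hasDerivAt_pow 2 t).div_const 2).congr_deriv ?_
    push_cast; ring
  have := (kapX_deriv ν t ht).mul (((kapE4_deriv ν t hν).const_mul ν).sub
    (hq.mul (kapE4_deriv (ν + 1) t (by positivity))))
  refine HasDerivAt.congr_deriv (f := kapQ ν) this ?_
  have hrec := kapE_rec ν (t ^ 2 / 4) hν
  rw [show ν + 1 + 1 = ν + 2 by ring]
  simp only [kapJ, Pi.sub_apply, Pi.mul_apply]
  generalize kapE ν (t ^ 2 / 4) = E0 at *
  generalize kapE (ν + 1) (t ^ 2 / 4) = E1 at *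
  generalize kapE (ν + 2) (t ^ 2 / 4) = E2 at *
  field_simp
  linear_combination (t ^ 2 * 4) * hrec

lemma kapJ_pred (ν : ℝ) (hν : 1 ≤ ν) : kapJ (ν - 1) ν = kapJ ν ν + kapQ ν ν / ν := by
  have hrec := kapE_rec (ν - 1) (ν ^ 2 / 4) (by linarith)
  rw [show ν - 1 + 1 = ν by ring, show ν - 1 + 2 = ν + 1 by ring] at hrec
  unfold kapJ kapQ
  rw [hrec, Real.rpow_sub_one (by positivity)]
  field_simp
  ring

lemma kapQ_nonneg (ν : ℝ) (hν : 0 < ν) : 0 ≤ kapQ ν ν := by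
  unfold kapQ
  have := kap_Q1 ν hν
  refine mul_nonneg (by positivity) ?_
  nlinarith

lemma kapJ_step (ν : ℝ) (hν : 1 ≤ ν) : kapJ ν (ν + 1) ≤ kapJ (ν - 1) ν := by
  rw [kapJ_pred ν hν]
  have hν0 : 0 < ν := by linarith
  have hQ : AntitoneOn (kapQ ν) (Set.Icc ν (ν + 1)) := by
    refine antitoneOn_of_deriv_nonpos (convex_Icc _ _) ?_ ?_ ?_
    · exact fun t ht => (kapQ_deriv ν t hν0.le (by linarith [ht.1])).continuousAt.continuousWithinAt
    · rw [interior_Icc]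
      exact fun t ht => (kapQ_deriv ν t hν0.le
        (by linarith [ht.1])).differentiableAt.differentiableWithinAt
    · rw [interior_Icc]
      intro t ht
      have ht0 : 0 < t := by linarith [ht.1]
      rw [(kapQ_deriv ν t hν0.le ht0).deriv]
      refine mul_nonpos_of_nonpos_of_nonneg (div_nonpos_of_nonpos_of_nonneg ?_ ht0.le) ?_
      · nlinarith [ht.1]
      · exact mul_nonneg (by positivity) (kapE_pos ν t hν0.le ht0 ht.2.le).le
  have h := (convex_Icc ν (ν + 1)).image_sub_le_mul_sub_of_deriv_le (f := kapJ ν)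
    (C := kapQ ν ν / ν)
    (fun t ht => (kapJ_deriv ν t hν0.le (by linarith [ht.1])).continuousAt.continuousWithinAt)
    (by
      rw [interior_Icc]
      exact fun t ht => (kapJ_deriv ν t hν0.le
        (by linarith [ht.1])).differentiableAt.differentiableWithinAt)
    (by
      rw [interior_Icc]
      intro t ht
      have ht0 : 0 < t := by linarith [ht.1]
      rw [(kapJ_deriv ν t hν0.le ht0).deriv]
      have h1 := hQ (Set.left_mem_Icc.2 (by linarith)) (Set.Ioo_subset_Icc_self ht) ht.1.le
      have h2 := kapQ_nonneg ν hν0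
      rw [div_le_div_iff₀ ht0 hν0]
      nlinarith [ht.1])
    ν (Set.left_mem_Icc.2 (by linarith)) (ν + 1) (Set.right_mem_Icc.2 (by linarith)) (by linarith)
  have : ν + 1 - ν = 1 := by ring
  rw [this] at h
  linarith

lemma kapE_alt (ν z : ℝ) (hν : 0 ≤ ν) (hz : 0 ≤ z) (hz1 : z ≤ 1) (k : ℕ) :
    kapE ν z ≤ ∑ i ∈ Finset.range (2 * k + 1), kapA ν i * z ^ i := by
  set f : ℕ → ℝ := fun k => z ^ k / ((k.factorial : ℝ) * Real.Gamma ((k : ℝ) + ν + 1)) with hf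
  have e : ∀ i, kapA ν i * z ^ i = (-1) ^ i * f i := by
    intro i; simp only [kapA, hf]; ring
  have hanti : Antitone f := by
    refine antitone_nat_of_succ_le fun n => ?_
    simp only [hf]
    have h : ((n + 1 : ℕ) : ℝ) + ν + 1 = ((n : ℝ) + ν + 1) + 1 := by push_cast; ring
    have hn : (0 : ℝ) < (n : ℝ) + ν + 1 := by positivity
    have hG := kap_Gamma_pos ν hν n
    rw [h, Real.Gamma_add_one hn.ne', Nat.factorial_succ]
    have hn0 : (0 : ℝ) ≤ n := by positivity
    have h3 : (0 : ℝ) < n.factorial := by positivity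
    push_cast
    gcongr ?_ / (?_ * ?_)
    · exact pow_le_pow_of_le_one hz hz1 (Nat.le_succ n)
    · nlinarith
    · nlinarith
  have ht := (kapE_summable ν z hν).hasSum.tendsto_sum_nat
  simp only [e] at ht ⊢
  have := hanti.tendsto_le_alternating_series ht k
  unfold kapE
  simpa only [e] using this

lemma kap_Gamma_low (μ : ℝ) (h0 : 0 ≤ μ) (h1 : μ ≤ 1) :
    1 ≤ Real.Gamma (μ + 1) * (1 + μ) ^ (1 - μ) := by
  rcases h0.eq_or_lt with rfl | h0
  · simp
  rcases h1.eq_or_lt with rfl | h1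
  · norm_num
  have hG : 0 < Real.Gamma (μ + 1) := Real.Gamma_pos_of_pos (by positivity)
  have := Real.Gamma_mul_add_mul_le_rpow_Gamma_mul_rpow_Gamma (s := μ + 1) (t := μ + 2) (a := μ)
    (b := 1 - μ) (by positivity) (by positivity) h0 (by linarith) (by ring)
  rw [show μ * (μ + 1) + (1 - μ) * (μ + 2) = 2 by ring, Real.Gamma_two,
    show μ + 2 = (μ + 1) + 1 by ring, Real.Gamma_add_one (s := μ + 1) (by positivity),
    Real.mul_rpow (by positivity) hG.le] at this
  have e : Real.Gamma (μ + 1) ^ μ * Real.Gamma (μ + 1) ^ (1 - μ) = Real.Gamma (μ + 1) := by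
    rw [← Real.rpow_add hG]; simp
  calc 1 ≤ _ := this
    _ = (Real.Gamma (μ + 1) ^ μ * Real.Gamma (μ + 1) ^ (1 - μ)) * (μ + 1) ^ (1 - μ) := by ring
    _ = _ := by rw [e, add_comm 1 μ]

/-- base: `J_ν(ν) ≤ 1` for `0 < ν ≤ 1`. -/
lemma kap_base1 (ν : ℝ) (h0 : 0 < ν) (h1 : ν ≤ 1) : kapJ ν ν ≤ 1 := by
  have hE := kapE_alt ν (ν ^ 2 / 4) h0.le (by positivity) (by nlinarith) 0
  have hG : 0 < Real.Gamma (ν + 1) := Real.Gamma_pos_of_pos (by positivity)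
  simp [kapA] at hE
  have hl := kap_Gamma_low ν h0.le h1
  have ham := Real.geom_mean_le_arith_mean2_weighted (w₁ := ν) (w₂ := 1 - ν) (p₁ := ν / 2)
    (p₂ := 1 + ν) h0.le (by linarith) (by positivity) (by positivity) (by ring)
  have hX : 0 < (ν / 2) ^ ν := by positivity
  have hY : 0 < (1 + ν) ^ (1 - ν) := by positivity
  unfold kapJ
  calc _ ≤ (ν / 2) ^ ν * (Real.Gamma (ν + 1))⁻¹ := by gcongr
    _ ≤ (ν / 2) ^ ν * (1 + ν) ^ (1 - ν) := by
        gcongr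
        rw [inv_le_iff_one_le_mul₀ hG]
        linarith
    _ ≤ 1 := by nlinarith

/-- base: `J_μ(μ+1) ≤ 1` for `0 ≤ μ ≤ 1`. -/
lemma kap_base2 (μ : ℝ) (h0 : 0 ≤ μ) (h1 : μ ≤ 1) : kapJ μ (μ + 1) ≤ 1 := by
  have hE := kapE_alt μ ((μ + 1) ^ 2 / 4) h0 (by positivity) (by nlinarith) 1
  have hG : 0 < Real.Gamma (μ + 1) := Real.Gamma_pos_of_pos (by positivity)
  have g1 : Real.Gamma (1 + μ + 1) = (μ + 1) * Real.Gamma (μ + 1) := by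
    rw [show 1 + μ + 1 = (μ + 1) + 1 by ring, Real.Gamma_add_one (by positivity)]
  have g2 : Real.Gamma (2 + μ + 1) = (μ + 2) * ((μ + 1) * Real.Gamma (μ + 1)) := by
    rw [show 2 + μ + 1 = (μ + 1 + 1) + 1 by ring, Real.Gamma_add_one (by positivity),
      Real.Gamma_add_one (by positivity)]
    ring
  have hE' : kapE μ ((μ + 1) ^ 2 / 4) ≤ (Real.Gamma (μ + 1))⁻¹ * (4 / 5) := by
    refine hE.trans ?_
    simp only [Finset.sum_range_succ, Finset.sum_range_zero, kapA]
    norm_num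
    rw [g1, g2]
    have : (1 - (μ + 1) / 4 + (μ + 1) ^ 3 / (32 * (μ + 2))) ≤ 4 / 5 := by
      have : (μ + 1) ^ 3 / (32 * (μ + 2)) ≤ (μ + 1) / 4 - 1 / 5 := by
        rw [div_le_iff₀ (by positivity)]
        nlinarith [mul_nonneg h0 (sub_nonneg.2 h1), mul_nonneg h0 (mul_nonneg h0 (sub_nonneg.2 h1))]
      linarith
    refine le_trans (le_of_eq ?_) (mul_le_mul_of_nonneg_left this (inv_pos.2 hG).le)
    field_simp
    ring
  have hl := kap_Gamma_low μ h0 h1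
  have ham := Real.geom_mean_le_arith_mean2_weighted (w₁ := μ) (w₂ := 1 - μ) (p₁ := 1 / 2)
    (p₂ := 1) h0 (by linarith) (by positivity) (by positivity) (by ring)
  rw [Real.one_rpow] at ham
  have hX : 0 < ((μ + 1) / 2) ^ μ := by positivity
  have hY : 0 < (1 + μ) ^ (1 - μ) := by positivity
  have hXY : ((μ + 1) / 2) ^ μ * (1 + μ) ^ (1 - μ) = (1 / 2) ^ μ * (1 + μ) := by
    rw [div_eq_mul_one_div, Real.mul_rpow (by positivity) (by positivity), add_comm μ 1,
      mul_comm ((1 + μ) ^ μ), mul_assoc, ← Real.rpow_add (by positivity)]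
    simp
  unfold kapJ
  calc _ ≤ ((μ + 1) / 2) ^ μ * ((Real.Gamma (μ + 1))⁻¹ * (4 / 5)) := by gcongr
    _ ≤ ((μ + 1) / 2) ^ μ * ((1 + μ) ^ (1 - μ) * (4 / 5)) := by
        gcongr
        rw [inv_le_iff_one_le_mul₀ hG]
        linarith
    _ = ((1 / 2) ^ μ * (1 + μ)) * (4 / 5) := by rw [← hXY]; ring
    _ ≤ 1 := by nlinarith [sq_nonneg (μ - 1 / 2)]

lemma kap_B (μ : ℝ) (h0 : 0 ≤ μ) (h1 : μ ≤ 1) (n : ℕ) : kapJ (μ + n) (μ + n + 1) ≤ 1 := by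
  induction n with
  | zero => simpa using kap_base2 μ h0 h1
  | succ n ih =>
    have hn : (0 : ℝ) ≤ n := by positivity
    have h := kapJ_step (μ + n + 1) (by linarith)
    rw [show μ + n + 1 - 1 = μ + n by ring] at h
    push_cast
    rw [← add_assoc]
    exact h.trans ih

lemma kap_J_le_one (ν : ℝ) (hν : 0 < ν) : kapJ ν ν ≤ 1 := by
  rcases le_total ν 1 with h | h
  · exact kap_base1 ν hν h
  have h1 := kapJ_pred ν h
  have h2 := kapQ_nonneg ν hν
  have h3 := kap_B (Int.fract (ν - 1)) (Int.fract_nonneg _) (Int.fract_lt_one _).le ⌊ν - 1⌋₊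
  have h4 : Int.fract (ν - 1) + (⌊ν - 1⌋₊ : ℝ) = ν - 1 := by
    rw [natCast_floor_eq_intCast_floor (by linarith)]
    exact Int.fract_add_floor _
  rw [h4, show ν - 1 + 1 = ν by ring, h1] at h3
  have : 0 ≤ kapQ ν ν / ν := by positivity
  linarith

theorem kapteyn_inequality (ν x : ℝ) (hν : 0 < ν) (hx : x ∈ Set.Ioo (0 : ℝ) 1) :
    0 < besselJ ν (ν * x) ∧
      besselJ ν (ν * x) <
        x ^ ν * Real.exp (ν * Real.sqrt (1 - x ^ 2)) / (1 + Real.sqrt (1 - x ^ 2)) ^ ν := by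
  have hx0 := hx.1
  obtain ⟨hE, -, hm⟩ := kap_main ν hν
  have hEx := hE x ⟨hx.1.le, hx.2.le⟩
  rw [besselJ_eq_s14 ν (ν * x) (by positivity), mul_pow]
  refine ⟨by positivity, ?_⟩
  have hlt := hm ⟨hx.1.le, hx.2.le⟩ (Set.right_mem_Icc.2 zero_le_one) hx.2
  have hH1 : kapH ν 1 = 1 := by simp [kapH, kapS]
  simp only [hH1, one_pow, mul_one] at hlt
  have hJ := kap_J_le_one ν hν
  unfold kapJ at hJ
  have hs := kapS_nonneg x
  have hHx : kapH ν x = (1 + kapS x) ^ ν * (Real.exp (ν * kapS x))⁻¹ := by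
    unfold kapH
    rw [Real.rpow_def_of_pos (by positivity), ← Real.exp_neg, ← Real.exp_add]
    congr 1; ring
  have hS : Real.sqrt (1 - x ^ 2) = kapS x := rfl
  have hSp : 0 < (1 + kapS x) ^ ν := by positivity
  have hep : 0 < Real.exp (ν * kapS x) := Real.exp_pos _
  have hnp : 0 < (ν / 2) ^ ν := by positivity
  have hxp : 0 < x ^ ν := by positivity
  have e1 : (ν * x / 2) ^ ν = (ν / 2) ^ ν * x ^ ν := by
    rw [← Real.mul_rpow (by positivity) (by positivity)]; congr 1; ring
  rw [hS, e1]
  have key : (ν / 2) ^ ν * (kapE ν (ν ^ 2 * x ^ 2 / 4) * kapH ν x) < 1 :=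
    (mul_lt_mul_of_pos_left hlt hnp).trans_le hJ
  rw [lt_div_iff₀ hSp]
  have key2 := mul_lt_mul_of_pos_left key (mul_pos hxp hep)
  rw [hHx] at key2
  calc _ = x ^ ν * Real.exp (ν * kapS x) * ((ν / 2) ^ ν * (kapE ν (ν ^ 2 * x ^ 2 / 4) *
      ((1 + kapS x) ^ ν * (Real.exp (ν * kapS x))⁻¹))) := by field_simp
    _ < _ := by simpa using key2
end
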